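/- arXiv:2109.04076 — 2 statements merged into one kernel-verified Lean document; each statement's English description precedes it below -/
import Mathlib

section
/- Let p ≥ 5 be a prime and let M be the Lie ring ⟨a, b | [b,a,b], [b,a,a,a,b] − [b,a,a,a,a,a], p•a, p•b, class 6⟩, i.e., the quotient of the free Lie ring on generators a, b by the Lie ideal generated by the listed elements together with the 7th term of the lower central series. Then the number of isomorphism classes of Lie rings L of cardinality p^8, nilpotent of class exactly 7, with L/L⁷ ≅ M equals p + 2·gcd(p−1,3) + gcd(p−1,7). -/
/-- An isomorphism between two Lie rings (Lie algebras over `ℤ`) exists. -/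
def IsLieIso (α β : Type*) [LieRing α] [LieRing β] : Prop :=
  ∃ e : α ≃ β, (∀ x y, e (x + y) = e x + e y) ∧ (∀ x y, e ⁅x, y⁆ = ⁅e x, e y⁆)

/-- A Lie ring is nilpotent of class exactly `c`: `L^{c+1} = 0` and `L^c ≠ 0`. -/
def LieClassEq (α : Type*) [LieRing α] (c : ℕ) : Prop :=
  LieModule.lowerCentralSeries ℤ α α c = ⊥ ∧ LieModule.lowerCentralSeries ℤ α α (c - 1) ≠ ⊥

/-- The free Lie ring on two generators. -/
abbrev FL : Type := FreeLieAlgebra ℤ (Fin 2)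

/-- The generator `a`. -/
noncomputable def ga : FL := FreeLieAlgebra.of ℤ 0
/-- The generator `b`. -/
noncomputable def gb : FL := FreeLieAlgebra.of ℤ 1
/-- The left-normed bracket `[b,a,b]`. -/
noncomputable def bab : FL := ⁅⁅gb, ga⁆, gb⁆
/-- The left-normed bracket `[b,a,a,a]`. -/
noncomputable def ba3 : FL := ⁅⁅⁅gb, ga⁆, ga⁆, ga⁆
/-- The left-normed bracket `[b,a,a,a,b]`. -/
noncomputable def ba3b : FL := ⁅ba3, gb⁆
/-- The left-normed bracket `[b,a,a,a,a]`. -/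
noncomputable def ba4 : FL := ⁅ba3, ga⁆
/-- The left-normed bracket `[b,a,a,a,a,a]`. -/
noncomputable def ba5 : FL := ⁅ba4, ga⁆

/-- The quotient of the free Lie ring on `a, b` by the Lie ideal generated by the
given relator set together with `p•a`, `p•b` and the 7th term of the lower central
series (i.e. the presentation is of class at most 6). -/
abbrev presLie (p : ℕ) (rels : Set FL) : Type :=
  FL ⧸ (LieSubmodule.lieSpan ℤ FL (rels ∪ {p • ga, p • gb}) ⊔
    LieModule.lowerCentralSeries ℤ FL FL 6)

/-- `s` is a Lie ring structure of maximal class 7 on a set of size `p^8` whose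
quotient by the 7th term of the lower central series is isomorphic to `β`. -/
def IsMaxClassDescendantOf (p : ℕ) (β : Type*) [LieRing β]
    (s : LieRing (Fin (p ^ 8))) : Prop := by
  letI := s
  exact LieClassEq (Fin (p ^ 8)) 7 ∧
    IsLieIso (Fin (p ^ 8) ⧸ LieModule.lowerCentralSeries ℤ (Fin (p ^ 8)) (Fin (p ^ 8)) 6) β

theorem lie_mem_lowerCentralSeries {L : Type*} [LieRing L] {k : ℕ} {u : L}
    (h : u ∈ LieModule.lowerCentralSeries ℤ L L k) (v : L) :
    ⁅u, v⁆ ∈ LieModule.lowerCentralSeries ℤ L L (k + 1) := by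
  rw [← lie_skew, LieModule.lowerCentralSeries_succ]
  exact neg_mem (LieSubmodule.lie_mem_lie (LieSubmodule.mem_top v) h)

theorem leftNormed_mem_lowerCentralSeries {L : Type*} [LieRing L] (a b : L) :
    ⁅⁅⁅⁅⁅⁅b, a⁆, a⁆, a⁆, a⁆, a⁆, a⁆ ∈ LieModule.lowerCentralSeries ℤ L L 6 := by
  iterate 6 apply lie_mem_lowerCentralSeries
  simp

/-! ### The covering Lie ring

`Cover` is the Lie ring on `ℤ⁸` with basis `a, b, c₁, …, c₆`, where `cᵢ = [b,a,…,a]`, of which all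
descendants are quotients. -/

/-- The elements `x a + y b + t₁ c₁ + ⋯ + t₆ c₆`. -/
@[ext]
structure Cover where
  x : ℤ
  y : ℤ
  t₁ : ℤ
  t₂ : ℤ
  t₃ : ℤ
  t₄ : ℤ
  t₅ : ℤ
  t₆ : ℤ

namespace Cover

instance : Zero Cover := ⟨⟨0, 0, 0, 0, 0, 0, 0, 0⟩⟩
instance : Add Cover := ⟨fun u v => ⟨u.x + v.x, u.y + v.y, u.t₁ + v.t₁, u.t₂ + v.t₂, u.t₃ + v.t₃,
  u.t₄ + v.t₄, u.t₅ + v.t₅, u.t₆ + v.t₆⟩⟩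
instance : Neg Cover := ⟨fun u => ⟨-u.x, -u.y, -u.t₁, -u.t₂, -u.t₃, -u.t₄, -u.t₅, -u.t₆⟩⟩
instance : Sub Cover := ⟨fun u v => ⟨u.x - v.x, u.y - v.y, u.t₁ - v.t₁, u.t₂ - v.t₂, u.t₃ - v.t₃,
  u.t₄ - v.t₄, u.t₅ - v.t₅, u.t₆ - v.t₆⟩⟩
instance : SMul ℕ Cover := ⟨fun n u => ⟨n * u.x, n * u.y, n * u.t₁, n * u.t₂, n * u.t₃,
  n * u.t₄, n * u.t₅, n * u.t₆⟩⟩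
instance : SMul ℤ Cover := ⟨fun n u => ⟨n * u.x, n * u.y, n * u.t₁, n * u.t₂, n * u.t₃,
  n * u.t₄, n * u.t₅, n * u.t₆⟩⟩

/-- The bracket with `[cᵢ,a] = cᵢ₊₁`, `[c₃,b] = [c₁,c₂] = c₅`, `[c₄,b] = 2c₆`, `[c₁,c₃] = c₆`. -/
instance : Bracket Cover Cover := ⟨fun u v =>
  ⟨0, 0, u.y * v.x - u.x * v.y, u.t₁ * v.x - u.x * v.t₁, u.t₂ * v.x - u.x * v.t₂,
    u.t₃ * v.x - u.x * v.t₃,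
    u.t₄ * v.x - u.x * v.t₄ + (u.t₃ * v.y - u.y * v.t₃) + (u.t₁ * v.t₂ - u.t₂ * v.t₁),
    u.t₅ * v.x - u.x * v.t₅ + 2 * (u.t₄ * v.y - u.y * v.t₄) + (u.t₁ * v.t₃ - u.t₃ * v.t₁)⟩⟩

theorem zero_def : (0 : Cover) = ⟨0, 0, 0, 0, 0, 0, 0, 0⟩ := rfl
theorem add_def (u v : Cover) : u + v = ⟨u.x + v.x, u.y + v.y, u.t₁ + v.t₁, u.t₂ + v.t₂,
  u.t₃ + v.t₃, u.t₄ + v.t₄, u.t₅ + v.t₅, u.t₆ + v.t₆⟩ := rfl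
theorem sub_def (u v : Cover) : u - v = ⟨u.x - v.x, u.y - v.y, u.t₁ - v.t₁, u.t₂ - v.t₂,
  u.t₃ - v.t₃, u.t₄ - v.t₄, u.t₅ - v.t₅, u.t₆ - v.t₆⟩ := rfl
theorem nsmul_def (n : ℕ) (u : Cover) : n • u = ⟨n * u.x, n * u.y, n * u.t₁, n * u.t₂, n * u.t₃,
  n * u.t₄, n * u.t₅, n * u.t₆⟩ := rfl
theorem zsmul_def (n : ℤ) (u : Cover) : n • u = ⟨n * u.x, n * u.y, n * u.t₁, n * u.t₂, n * u.t₃,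
  n * u.t₄, n * u.t₅, n * u.t₆⟩ := rfl
theorem lie_def (u v : Cover) : ⁅u, v⁆ =
  ⟨0, 0, u.y * v.x - u.x * v.y, u.t₁ * v.x - u.x * v.t₁, u.t₂ * v.x - u.x * v.t₂,
    u.t₃ * v.x - u.x * v.t₃,
    u.t₄ * v.x - u.x * v.t₄ + (u.t₃ * v.y - u.y * v.t₃) + (u.t₁ * v.t₂ - u.t₂ * v.t₁),
    u.t₅ * v.x - u.x * v.t₅ + 2 * (u.t₄ * v.y - u.y * v.t₄) + (u.t₁ * v.t₃ - u.t₃ * v.t₁)⟩ := rfl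

/-- The coordinates. -/
def coords (u : Cover) : ℤ × ℤ × ℤ × ℤ × ℤ × ℤ × ℤ × ℤ :=
  (u.x, u.y, u.t₁, u.t₂, u.t₃, u.t₄, u.t₅, u.t₆)

theorem coords_injective : Function.Injective coords := by
  intro u v h
  simp only [coords, Prod.mk.injEq] at h
  ext <;> simp [h]

instance : AddCommGroup Cover :=
  coords_injective.addCommGroup coords rfl (fun _ _ => rfl) (fun _ => rfl) (fun _ _ => rfl)
    (fun u n => by simp [coords, nsmul_def]) (fun u n => by simp [coords, zsmul_def])

instance : LieRing Cover where
  add_lie u v w := by ext <;> simp only [lie_def, add_def] <;> ring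
  lie_add u v w := by ext <;> simp only [lie_def, add_def] <;> ring
  lie_self u := by ext <;> simp only [lie_def, zero_def] <;> ring
  leibniz_lie u v w := by ext <;> simp only [lie_def, add_def] <;> ring

/-- The generator `a`. -/
def a : Cover := ⟨1, 0, 0, 0, 0, 0, 0, 0⟩
/-- The generator `b`. -/
def b : Cover := ⟨0, 1, 0, 0, 0, 0, 0, 0⟩
/-- The basis element `c₁ = [b,a]`. -/
def c₁ : Cover := ⟨0, 0, 1, 0, 0, 0, 0, 0⟩
/-- The basis element `c₂ = [b,a,a]`. -/
def c₂ : Cover := ⟨0, 0, 0, 1, 0, 0, 0, 0⟩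
/-- The basis element `c₃ = [b,a,a,a]`. -/
def c₃ : Cover := ⟨0, 0, 0, 0, 1, 0, 0, 0⟩
/-- The basis element `c₄ = [b,a,a,a,a]`. -/
def c₄ : Cover := ⟨0, 0, 0, 0, 0, 1, 0, 0⟩
/-- The basis element `c₅ = [b,a,a,a,a,a]`. -/
def c₅ : Cover := ⟨0, 0, 0, 0, 0, 0, 1, 0⟩
/-- The basis element `c₆ = [b,a,a,a,a,a,a]`. -/
def c₆ : Cover := ⟨0, 0, 0, 0, 0, 0, 0, 1⟩

theorem lie_b_a : ⁅b, a⁆ = c₁ := by ext <;> simp [lie_def, a, b, c₁]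
theorem lie_c₁_a : ⁅c₁, a⁆ = c₂ := by ext <;> simp [lie_def, a, c₁, c₂]
theorem lie_c₂_a : ⁅c₂, a⁆ = c₃ := by ext <;> simp [lie_def, a, c₂, c₃]
theorem lie_c₃_a : ⁅c₃, a⁆ = c₄ := by ext <;> simp [lie_def, a, c₃, c₄]
theorem lie_c₄_a : ⁅c₄, a⁆ = c₅ := by ext <;> simp [lie_def, a, c₄, c₅]
theorem lie_c₅_a : ⁅c₅, a⁆ = c₆ := by ext <;> simp [lie_def, a, c₅, c₆]
theorem lie_c₁_b : ⁅c₁, b⁆ = 0 := by ext <;> simp [lie_def, b, c₁, zero_def]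
theorem lie_c₃_b : ⁅c₃, b⁆ = c₅ := by ext <;> simp [lie_def, b, c₃, c₅]

theorem eq_sum (u : Cover) : u = u.x • a + u.y • b + u.t₁ • c₁ + u.t₂ • c₂ + u.t₃ • c₃ +
    u.t₄ • c₄ + u.t₅ • c₅ + u.t₆ • c₆ := by
  ext <;> simp [zsmul_def, add_def, a, b, c₁, c₂, c₃, c₄, c₅, c₆]

/-- The `k`-th term of the filtration by weight. -/
def filtration (k : ℕ) : LieIdeal ℤ Cover where
  carrier := {u | (1 ≤ k → u.x = 0 ∧ u.y = 0) ∧ (2 ≤ k → u.t₁ = 0) ∧ (3 ≤ k → u.t₂ = 0) ∧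
    (4 ≤ k → u.t₃ = 0) ∧ (5 ≤ k → u.t₄ = 0) ∧ (6 ≤ k → u.t₅ = 0) ∧ (7 ≤ k → u.t₆ = 0)}
  add_mem' := by
    rintro u v ⟨hu, hu1, hu2, hu3, hu4, hu5, hu6⟩ ⟨hv, hv1, hv2, hv3, hv4, hv5, hv6⟩
    simp only [add_def, Set.mem_ofPred_eq]
    grind
  zero_mem' := by simp [zero_def]
  smul_mem' := by
    rintro n u ⟨hu, hu1, hu2, hu3, hu4, hu5, hu6⟩
    simp only [zsmul_def, Set.mem_ofPred_eq]
    grind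
  lie_mem := by
    rintro u v ⟨hv, hv1, hv2, hv3, hv4, hv5, hv6⟩
    simp only [lie_def, Set.mem_ofPred_eq]
    refine ⟨by simp, ?_, ?_, ?_, ?_, ?_, ?_⟩ <;> intro hk
    · simp [hv (by omega)]
    · simp [hv (by omega), hv1 (by omega)]
    · simp [hv (by omega), hv2 (by omega)]
    · simp [hv (by omega), hv3 (by omega)]
    · simp [hv (by omega), hv1 (by omega), hv2 (by omega), hv3 (by omega), hv4 (by omega)]
    · simp [hv (by omega), hv1 (by omega), hv3 (by omega), hv4 (by omega), hv5 (by omega)]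

theorem mem_filtration {k : ℕ} {u : Cover} : u ∈ filtration k ↔
    (1 ≤ k → u.x = 0 ∧ u.y = 0) ∧ (2 ≤ k → u.t₁ = 0) ∧ (3 ≤ k → u.t₂ = 0) ∧
    (4 ≤ k → u.t₃ = 0) ∧ (5 ≤ k → u.t₄ = 0) ∧ (6 ≤ k → u.t₅ = 0) ∧ (7 ≤ k → u.t₆ = 0) := Iff.rfl

theorem lowerCentralSeries_le (k : ℕ) :
    LieModule.lowerCentralSeries ℤ Cover Cover k ≤ filtration k := by
  induction k with
  | zero => intro u _; simp [mem_filtration]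
  | succ k ih =>
    rw [LieModule.lowerCentralSeries_succ, LieSubmodule.lie_le_iff]
    intro u _ v hv
    obtain ⟨h, h1, h2, h3, h4, h5, h6⟩ := mem_filtration.1 (ih hv)
    simp only [mem_filtration, lie_def]
    refine ⟨by simp, ?_, ?_, ?_, ?_, ?_, ?_⟩ <;> intro hk
    · simp [h (by omega)]
    · simp [h (by omega), h1 (by omega)]
    · simp [h (by omega), h2 (by omega)]
    · simp [h (by omega), h3 (by omega)]
    · simp [h (by omega), h1 (by omega), h2 (by omega), h3 (by omega), h4 (by omega)]
    · simp [h (by omega), h1 (by omega), h3 (by omega), h4 (by omega), h5 (by omega)]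

theorem c₆_mem : c₆ ∈ LieModule.lowerCentralSeries ℤ Cover Cover 6 := by
  rw [← lie_c₅_a, ← lie_c₄_a, ← lie_c₃_a, ← lie_c₂_a, ← lie_c₁_a, ← lie_b_a]
  exact leftNormed_mem_lowerCentralSeries a b

theorem eq_of_mem_lowerCentralSeries_six {u : Cover}
    (h : u ∈ LieModule.lowerCentralSeries ℤ Cover Cover 6) : u = u.t₆ • c₆ := by
  have := mem_filtration.1 (lowerCentralSeries_le 6 h)
  ext <;> simp_all [zsmul_def, c₆]

theorem eq_of_mem_lowerCentralSeries_five {u : Cover}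
    (h : u ∈ LieModule.lowerCentralSeries ℤ Cover Cover 5) : u = u.t₅ • c₅ + u.t₆ • c₆ := by
  have := mem_filtration.1 (lowerCentralSeries_le 5 h)
  ext <;> simp_all [zsmul_def, add_def, c₅, c₆]

theorem eq_of_mem_lowerCentralSeries_seven {u : Cover}
    (h : u ∈ LieModule.lowerCentralSeries ℤ Cover Cover 7) : u = 0 := by
  have := mem_filtration.1 (lowerCentralSeries_le 7 h)
  ext <;> simp_all [zero_def]

end Cover

/-! ### Bracket tables -/

section Table

variable {L : Type*} [LieRing L]

theorem lie_lie_right (x y z : L) : ⁅⁅x, y⁆, z⁆ = ⁅⁅x, z⁆, y⁆ + ⁅x, ⁅y, z⁆⁆ := by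
  rw [lie_lie, ← lie_skew y ⁅x, z⁆]
  abel

/-- The defining relations of a descendant, up to central errors `z₁` and `z₂`. -/
structure NearRel (a b c₁ c₂ c₃ c₄ c₅ c₆ z₁ z₂ : L) : Prop where
  ba : ⁅b, a⁆ = c₁
  h1a : ⁅c₁, a⁆ = c₂
  h2a : ⁅c₂, a⁆ = c₃
  h3a : ⁅c₃, a⁆ = c₄
  h4a : ⁅c₄, a⁆ = c₅
  h5a : ⁅c₅, a⁆ = c₆
  h1b : ⁅c₁, b⁆ = z₁
  h3b : ⁅c₃, b⁆ = c₅ + z₂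
  hc₆ : ∀ x : L, ⁅c₆, x⁆ = (0 : L)
  hz₁ : ∀ x : L, ⁅z₁, x⁆ = (0 : L)
  hz₂ : ∀ x : L, ⁅z₂, x⁆ = (0 : L)

namespace NearRel

variable {a b c₁ c₂ c₃ c₄ c₅ c₆ z₁ z₂ : L}

theorem ab (h : NearRel a b c₁ c₂ c₃ c₄ c₅ c₆ z₁ z₂) : ⁅a, b⁆ = -c₁ := by
  rw [← lie_skew, h.ba]

theorem lie_lie_b (h : NearRel a b c₁ c₂ c₃ c₄ c₅ c₆ z₁ z₂) (x : L) :
    ⁅⁅x, a⁆, b⁆ = ⁅⁅x, b⁆, a⁆ - ⁅x, c₁⁆ := by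
  rw [lie_lie_right, h.ab, lie_neg, sub_eq_add_neg]

theorem lie_lie_a (x y : L) : ⁅x, ⁅y, a⁆⁆ = ⁅⁅x, y⁆, a⁆ - ⁅⁅x, a⁆, y⁆ := by
  rw [lie_lie_right x y a]
  abel

theorem h2b (h : NearRel a b c₁ c₂ c₃ c₄ c₅ c₆ z₁ z₂) : ⁅c₂, b⁆ = 0 := by
  rw [← h.h1a, h.lie_lie_b, h.h1b, h.hz₁, lie_self, sub_zero]

theorem h21 (h : NearRel a b c₁ c₂ c₃ c₄ c₅ c₆ z₁ z₂) : ⁅c₂, c₁⁆ = -(c₅ + z₂) := by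
  have := h.lie_lie_b c₂
  rw [h.h2a, h.h3b, h.h2b, zero_lie] at this
  rw [this, zero_sub, neg_neg]

theorem h31 (h : NearRel a b c₁ c₂ c₃ c₄ c₅ c₆ z₁ z₂) : ⁅c₃, c₁⁆ = -c₆ := by
  rw [← h.h2a, lie_lie_right, h.h21, ← lie_skew a, h.h1a, neg_lie, add_lie, h.h5a, h.hz₂, lie_neg,
    lie_self]
  simp

theorem h4b (h : NearRel a b c₁ c₂ c₃ c₄ c₅ c₆ z₁ z₂) : ⁅c₄, b⁆ = (2 : ℤ) • c₆ := by
  rw [← h.h3a, h.lie_lie_b, h.h3b, add_lie, h.h5a, h.hz₂, h.h31]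
  module

theorem h5b (h : NearRel a b c₁ c₂ c₃ c₄ c₅ c₆ z₁ z₂) : ⁅c₅, b⁆ = 0 := by
  have : ⁅⁅c₂, c₁⁆, b⁆ = 0 := by
    rw [lie_lie_right, h.h2b, h.h1b, ← lie_skew c₂ z₁, h.hz₁]
    simp
  rwa [h.h21, neg_lie, add_lie, h.hz₂, add_zero, neg_eq_zero] at this

theorem h41 (h : NearRel a b c₁ c₂ c₃ c₄ c₅ c₆ z₁ z₂) : ⁅c₄, c₁⁆ = 0 := by
  have := h.lie_lie_b c₄
  rwa [h.h4a, h.h5b, h.h4b, smul_lie, h.hc₆, smul_zero, zero_sub, eq_comm, neg_eq_zero] at this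

theorem h32 (h : NearRel a b c₁ c₂ c₃ c₄ c₅ c₆ z₁ z₂) : ⁅c₃, c₂⁆ = 0 := by
  rw [← h.h1a, lie_lie_a, h.h31, neg_lie, h.hc₆, h.h3a, h.h41]
  simp

theorem h51 (h : NearRel a b c₁ c₂ c₃ c₄ c₅ c₆ z₁ z₂) : ⁅c₅, c₁⁆ = 0 := by
  rw [← h.ba, lie_lie_a, h.h5b, h.h5a, h.hc₆]
  simp

theorem h52 (h : NearRel a b c₁ c₂ c₃ c₄ c₅ c₆ z₁ z₂) : ⁅c₅, c₂⁆ = 0 := by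
  rw [← h.h1a, lie_lie_a, h.h51, h.h5a, h.hc₆]
  simp

theorem h53 (h : NearRel a b c₁ c₂ c₃ c₄ c₅ c₆ z₁ z₂) : ⁅c₅, c₃⁆ = 0 := by
  rw [← h.h2a, lie_lie_a, h.h52, h.h5a, h.hc₆]
  simp

theorem h54 (h : NearRel a b c₁ c₂ c₃ c₄ c₅ c₆ z₁ z₂) : ⁅c₅, c₄⁆ = 0 := by
  rw [← h.h3a, lie_lie_a, h.h53, h.h5a, h.hc₆]
  simp

theorem h42 (h : NearRel a b c₁ c₂ c₃ c₄ c₅ c₆ z₁ z₂) : ⁅c₄, c₂⁆ = 0 := by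
  rw [← h.h1a, lie_lie_a, h.h41, h.h4a, h.h51]
  simp

theorem h43 (h : NearRel a b c₁ c₂ c₃ c₄ c₅ c₆ z₁ z₂) : ⁅c₄, c₃⁆ = 0 := by
  rw [← h.h2a, lie_lie_a, h.h42, h.h4a, h.h52]
  simp

/-- The exact relations determine a homomorphism from the covering ring. -/
theorem exists_hom (h : NearRel a b c₁ c₂ c₃ c₄ c₅ c₆ 0 0) :
    ∃ φ : Cover →ₗ⁅ℤ⁆ L, φ Cover.a = a ∧ φ Cover.b = b := by
  have r (x y z : L) (e : ⁅x, y⁆ = z) : ⁅y, x⁆ = -z := by rw [← lie_skew, e]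
  refine ⟨{ toFun := fun u => u.x • a + u.y • b + u.t₁ • c₁ + u.t₂ • c₂ + u.t₃ • c₃ +
              u.t₄ • c₄ + u.t₅ • c₅ + u.t₆ • c₆
            map_add' := fun u v => by simp only [Cover.add_def]; module
            map_smul' := fun n u => by
              simp only [Cover.zsmul_def, eq_intCast, Int.cast_id]; module
            map_lie' := fun {u v} => ?_ }, ?_, ?_⟩
  · have c6 (x : L) : ⁅x, c₆⁆ = 0 := by rw [← lie_skew, h.hc₆, neg_zero]
    simp only [lie_add, add_lie, smul_lie, lie_smul, lie_self, h.ba, h.h1a, h.h2a, h.h3a, h.h4a,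
      h.h5a, h.h1b, h.h2b, h.h3b, h.h4b, h.h5b, h.h21, h.h31, h.h41, h.h51, h.h32, h.h42, h.h52,
      h.h43, h.h53, h.h54, h.hc₆, c6, h.ab, r _ _ _ h.h1a, r _ _ _ h.h2a, r _ _ _ h.h3a,
      r _ _ _ h.h4a, r _ _ _ h.h5a, r _ _ _ h.h1b, r _ _ _ h.h2b, r _ _ _ h.h3b, r _ _ _ h.h4b,
      r _ _ _ h.h5b, r _ _ _ h.h21, r _ _ _ h.h31, r _ _ _ h.h41, r _ _ _ h.h51, r _ _ _ h.h32,
      r _ _ _ h.h42, r _ _ _ h.h52, r _ _ _ h.h43, r _ _ _ h.h53, r _ _ _ h.h54, Cover.lie_def]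
    module
  · simp [Cover.a]
  · simp [Cover.b]

end NearRel

end Table

/-! ### Generalities on Lie rings -/

section General

variable {L M : Type*} [LieRing L] [LieRing M]

theorem isLieIso_of_ker_eq {A B C : Type*} [LieRing A] [LieRing B] [LieRing C]
    (f : A →ₗ⁅ℤ⁆ B) (g : A →ₗ⁅ℤ⁆ C) (hf : Function.Surjective f) (hg : Function.Surjective g)
    (h : ∀ x, f x = 0 ↔ g x = 0) : IsLieIso B C := by
  have key (x y) : f x = f y ↔ g x = g y := by
    rw [← sub_eq_zero, ← map_sub, h, map_sub, sub_eq_zero]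
  have e (x : A) : g (Function.surjInv hf (f x)) = g x :=
    (key _ _).1 (Function.surjInv_eq hf (f x))
  refine ⟨Equiv.ofBijective (fun y => g (Function.surjInv hf y)) ⟨?_, ?_⟩, ?_, ?_⟩
  · intro y z hyz
    obtain ⟨y, rfl⟩ := hf y
    obtain ⟨z, rfl⟩ := hf z
    simp only [e] at hyz
    exact (key _ _).2 hyz
  · intro z
    obtain ⟨x, rfl⟩ := hg z
    exact ⟨f x, e x⟩
  · intro y z
    obtain ⟨y, rfl⟩ := hf y
    obtain ⟨z, rfl⟩ := hf z
    rw [← map_add]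
    change g _ = g _ + g _
    rw [e, e, e, map_add]
  · intro y z
    obtain ⟨y, rfl⟩ := hf y
    obtain ⟨z, rfl⟩ := hf z
    rw [← LieHom.map_lie]
    change g _ = ⁅g _, g _⁆
    rw [e, e, e, LieHom.map_lie]

/-- The Lie homomorphism underlying an isomorphism of Lie rings. -/
theorem IsLieIso.exists_hom (h : IsLieIso L M) :
    ∃ f : L →ₗ⁅ℤ⁆ M, Function.Bijective f := by
  obtain ⟨e, ha, hl⟩ := h
  exact ⟨{ (AddMonoidHom.mk' e ha).toIntLinearMap with map_lie' := fun {x y} => hl x y },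
    e.bijective⟩

/-- The projection to a quotient, as a homomorphism of Lie rings. -/
def quotientHom (I : LieIdeal ℤ L) : L →ₗ⁅ℤ⁆ L ⧸ I :=
  { (LieSubmodule.Quotient.mk' I : L →ₗ[ℤ] L ⧸ I) with
    map_lie' := fun {x y} => LieSubmodule.Quotient.mk_bracket I x y }

theorem quotientHom_surjective (I : LieIdeal ℤ L) : Function.Surjective (quotientHom I) :=
  LieSubmodule.Quotient.surjective_mk' I

theorem quotientHom_eq_zero {I : LieIdeal ℤ L} {x : L} : quotientHom I x = 0 ↔ x ∈ I :=
  LieSubmodule.Quotient.mk_eq_zero I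

theorem map_mem_lowerCentralSeries (f : L →ₗ⁅ℤ⁆ M) {k : ℕ} {x : L}
    (hx : x ∈ LieModule.lowerCentralSeries ℤ L L k) :
    f x ∈ LieModule.lowerCentralSeries ℤ M M k :=
  LieIdeal.map_lowerCentralSeries_le k (LieIdeal.mem_map hx)

theorem exists_mem_lowerCentralSeries (f : L →ₗ⁅ℤ⁆ M) (hf : Function.Surjective f) {k : ℕ} {y : M}
    (hy : y ∈ LieModule.lowerCentralSeries ℤ M M k) :
    ∃ x ∈ LieModule.lowerCentralSeries ℤ L L k, f x = y := by
  rw [← LieIdeal.lowerCentralSeries_map_eq k hf] at hy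
  obtain ⟨⟨x, hx⟩, h⟩ := LieIdeal.mem_map_of_surjective hf hy
  exact ⟨x, hx, h⟩

end General

/-! ### The presented Lie ring -/

section Presented

theorem freeLie_exists_hom {L : Type*} [LieRing L] (a b : L) :
    ∃ f : FL →ₗ⁅ℤ⁆ L, f ga = a ∧ f gb = b := by
  let f := FreeLieAlgebra.lift ℤ ![a, b]
  refine ⟨{ f.toLinearMap.toAddMonoidHom.toIntLinearMap with
    map_lie' := fun {x y} => LieHom.map_lie f x y }, ?_, ?_⟩
  · exact FreeLieAlgebra.lift_of_apply ![a, b] 0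
  · exact FreeLieAlgebra.lift_of_apply ![a, b] 1

theorem freeLie_hom_ext {L : Type*} [LieRing L] {f g : FL →ₗ⁅ℤ⁆ L} (ha : f ga = g ga)
    (hb : f gb = g gb) (x : FL) : f x = g x := by
  have : f = g := by
    apply FreeLieAlgebra.hom_ext
    intro i
    fin_cases i
    · exact ha
    · exact hb
  rw [this]

theorem freeLie_mem_range {L M : Type*} [LieRing L] [LieRing M] (f : FL →ₗ⁅ℤ⁆ M) (g : L →ₗ⁅ℤ⁆ M)
    {a b : L} (ha : g a = f ga) (hb : g b = f gb) (x : FL) : ∃ y, g y = f x := by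
  obtain ⟨h, h1, h2⟩ := freeLie_exists_hom a b
  exact ⟨h x, freeLie_hom_ext (f := g.comp h) (g := f) (by simp [h1, ha]) (by simp [h2, hb]) x⟩

end Presented

section Models

/-- The ideal of the covering ring imposing `p a = γ c₆` and `p b = δ c₆`. -/
def relIdeal (p : ℕ) (γ δ : ZMod p) : LieIdeal ℤ Cover where
  carrier := {u | ∃ m n : ℤ, u.x = p * m ∧ u.y = p * n ∧ (p : ℤ) ∣ u.t₁ ∧ (p : ℤ) ∣ u.t₂ ∧
    (p : ℤ) ∣ u.t₃ ∧ (p : ℤ) ∣ u.t₄ ∧ (p : ℤ) ∣ u.t₅ ∧ (u.t₆ : ZMod p) + γ * m + δ * n = 0}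
  add_mem' := by
    rintro u v ⟨m, n, hx, hy, h1, h2, h3, h4, h5, h6⟩ ⟨m', n', hx', hy', h1', h2', h3', h4', h5', h6'⟩
    refine ⟨m + m', n + n', ?_, ?_, dvd_add h1 h1', dvd_add h2 h2', dvd_add h3 h3', dvd_add h4 h4',
      dvd_add h5 h5', ?_⟩
    · simp only [Cover.add_def, hx, hx']; ring
    · simp only [Cover.add_def, hy, hy']; ring
    · simp only [Cover.add_def]; push_cast; linear_combination h6 + h6'
  zero_mem' := ⟨0, 0, by simp [Cover.zero_def]⟩
  smul_mem' := by
    rintro k u ⟨m, n, hx, hy, h1, h2, h3, h4, h5, h6⟩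
    refine ⟨k * m, k * n, ?_, ?_, h1.mul_left k, h2.mul_left k, h3.mul_left k, h4.mul_left k,
      h5.mul_left k, ?_⟩
    · simp only [Cover.zsmul_def, hx]; ring
    · simp only [Cover.zsmul_def, hy]; ring
    · simp only [Cover.zsmul_def]; push_cast; linear_combination (k : ZMod p) * h6
  lie_mem := by
    rintro u v ⟨m, n, hx, hy, ⟨k1, h1⟩, ⟨k2, h2⟩, ⟨k3, h3⟩, ⟨k4, h4⟩, ⟨k5, h5⟩, h6⟩
    refine ⟨0, 0, by simp [Cover.lie_def], by simp [Cover.lie_def], ?_⟩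
    simp only [Cover.lie_def, hx, hy, h1, h2, h3, h4, h5]
    refine ⟨⟨u.y * m - u.x * n, by ring⟩, ⟨u.t₁ * m - u.x * k1, by ring⟩,
      ⟨u.t₂ * m - u.x * k2, by ring⟩, ⟨u.t₃ * m - u.x * k3, by ring⟩,
      ⟨u.t₄ * m - u.x * k4 + (u.t₃ * n - u.y * k3) + (u.t₁ * k2 - u.t₂ * k1), by ring⟩, ?_⟩
    simp

variable {p : ℕ} {γ δ : ZMod p}

theorem mem_relIdeal {u : Cover} : u ∈ relIdeal p γ δ ↔
    ∃ m n : ℤ, u.x = p * m ∧ u.y = p * n ∧ (p : ℤ) ∣ u.t₁ ∧ (p : ℤ) ∣ u.t₂ ∧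
    (p : ℤ) ∣ u.t₃ ∧ (p : ℤ) ∣ u.t₄ ∧ (p : ℤ) ∣ u.t₅ ∧ (u.t₆ : ZMod p) + γ * m + δ * n = 0 := Iff.rfl

/-- `L` is isomorphic to the quotient of the covering ring by `relIdeal p γ δ`. -/
def Models (p : ℕ) (γ δ : ZMod p) (L : Type*) [LieRing L] : Prop :=
  ∃ φ : Cover →ₗ⁅ℤ⁆ L, Function.Surjective φ ∧ ∀ u, φ u = 0 ↔ u ∈ relIdeal p γ δ

theorem hom_eq_zero_of_mem {L : Type*} [LieRing L] (φ : Cover →ₗ⁅ℤ⁆ L) {g d : ℤ}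
    (ha : (p : ℤ) • φ Cover.a = g • φ Cover.c₆) (hb : (p : ℤ) • φ Cover.b = d • φ Cover.c₆)
    {u : Cover} (hu : u ∈ relIdeal p (g : ZMod p) (d : ZMod p)) : φ u = 0 := by
  obtain ⟨m, n, hx, hy, ⟨k1, h1⟩, ⟨k2, h2⟩, ⟨k3, h3⟩, ⟨k4, h4⟩, ⟨k5, h5⟩, h6⟩ := hu
  have e1 : (p : ℤ) • φ Cover.c₁ = 0 := by
    rw [← Cover.lie_b_a, LieHom.map_lie, ← lie_smul, ha, lie_smul, ← LieHom.map_lie,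
      show ⁅Cover.b, Cover.c₆⁆ = 0 by rfl, map_zero, smul_zero]
  have e2 : (p : ℤ) • φ Cover.c₂ = 0 := by
    rw [← Cover.lie_c₁_a, LieHom.map_lie, ← smul_lie, e1, zero_lie]
  have e3 : (p : ℤ) • φ Cover.c₃ = 0 := by
    rw [← Cover.lie_c₂_a, LieHom.map_lie, ← smul_lie, e2, zero_lie]
  have e4 : (p : ℤ) • φ Cover.c₄ = 0 := by
    rw [← Cover.lie_c₃_a, LieHom.map_lie, ← smul_lie, e3, zero_lie]
  have e5 : (p : ℤ) • φ Cover.c₅ = 0 := by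
    rw [← Cover.lie_c₄_a, LieHom.map_lie, ← smul_lie, e4, zero_lie]
  have e6 : (p : ℤ) • φ Cover.c₆ = 0 := by
    rw [← Cover.lie_c₅_a, LieHom.map_lie, ← smul_lie, e5, zero_lie]
  have h : ((u.t₆ + g * m + d * n : ℤ) : ZMod p) = 0 := by push_cast; exact h6
  obtain ⟨k, hk⟩ := (ZMod.intCast_zmod_eq_zero_iff_dvd _ p).1 h
  rw [Cover.eq_sum u, hx, hy, h1, h2, h3, h4, h5, show u.t₆ = p * k - g * m - d * n by linarith]
  simp only [map_add, map_zsmul]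
  linear_combination (norm := module) m • ha + n • hb + k1 • e1 + k2 • e2 + k3 • e3 + k4 • e4 + k5 • e5 +
    k • e6

/-- A lift of an element of the covering ring to the free Lie ring. -/
noncomputable def coverLift (u : Cover) : FL :=
  u.x • ga + u.y • gb + u.t₁ • ⁅gb, ga⁆ + u.t₂ • ⁅⁅gb, ga⁆, ga⁆ + u.t₃ • ba3 + u.t₄ • ba4 +
    u.t₅ • ba5 + u.t₆ • ⁅ba5, ga⁆

theorem map_coverLift {L : Type*} [LieRing L] (f : FL →ₗ⁅ℤ⁆ L) (φ : Cover →ₗ⁅ℤ⁆ L)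
    (ha : f ga = φ Cover.a) (hb : f gb = φ Cover.b) (u : Cover) : f (coverLift u) = φ u := by
  conv_rhs => rw [Cover.eq_sum u, ← Cover.lie_c₅_a, ← Cover.lie_c₄_a, ← Cover.lie_c₃_a,
    ← Cover.lie_c₂_a, ← Cover.lie_c₁_a, ← Cover.lie_b_a]
  simp only [coverLift, ba5, ba4, ba3, map_add, map_zsmul, LieHom.map_lie, ha, hb]

theorem exists_hom_of_relations {p : ℕ} {M : Type*} [LieRing M] (π : FL →ₗ⁅ℤ⁆ M)
    (hπs : Function.Surjective π) (h1 : π bab = 0) (h2 : π (ba3b - ba5) = 0) (h3 : π (p • ga) = 0)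
    (h4 : π (p • gb) = 0) (h6 : π ⁅ba5, ga⁆ = 0) :
    ∃ θ : Cover →ₗ⁅ℤ⁆ M, Function.Surjective θ ∧ θ Cover.a = π ga ∧ θ Cover.b = π gb ∧
      (p : ℤ) • θ Cover.a = 0 ∧ (p : ℤ) • θ Cover.b = 0 ∧ θ Cover.c₆ = 0 := by
  simp only [bab, ba3b, ba5, ba4, ba3, map_sub, LieHom.map_lie] at h1 h2 h6
  obtain ⟨θ, ha, hb⟩ := NearRel.exists_hom (a := π ga) (b := π gb)
    ⟨rfl, rfl, rfl, rfl, rfl, rfl, h1, by rw [add_zero]; exact sub_eq_zero.1 h2,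
      by rw [h6]; exact zero_lie, zero_lie, zero_lie⟩
  refine ⟨θ, ?_, ha, hb, ?_, ?_, ?_⟩
  · intro z
    obtain ⟨w, rfl⟩ := hπs z
    exact freeLie_mem_range π θ ha hb w
  · rw [ha, natCast_zsmul, ← map_nsmul, h3]
  · rw [hb, natCast_zsmul, ← map_nsmul, h4]
  · rw [← Cover.lie_c₅_a, ← Cover.lie_c₄_a, ← Cover.lie_c₃_a, ← Cover.lie_c₂_a, ← Cover.lie_c₁_a,
      ← Cover.lie_b_a]
    simp only [LieHom.map_lie, ha, hb, h6]

theorem presLie_exists_hom (p : ℕ) :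
    ∃ (π : FL →ₗ⁅ℤ⁆ presLie p {bab, ba3b - ba5}) (θ : Cover →ₗ⁅ℤ⁆ presLie p {bab, ba3b - ba5}),
      Function.Surjective θ ∧ θ Cover.a = π ga ∧ θ Cover.b = π gb ∧
      (p : ℤ) • θ Cover.a = 0 ∧ (p : ℤ) • θ Cover.b = 0 ∧ θ Cover.c₆ = 0 ∧
      ∀ x, π x = 0 → x ∈ (LieSubmodule.lieSpan ℤ FL ({bab, ba3b - ba5} ∪ {p • ga, p • gb}) ⊔
        LieModule.lowerCentralSeries ℤ FL FL 6) := by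
  obtain ⟨π, hπs, hπ⟩ : ∃ π : FL →ₗ⁅ℤ⁆ presLie p {bab, ba3b - ba5}, Function.Surjective π ∧
      ∀ x, π x = 0 ↔ x ∈ (LieSubmodule.lieSpan ℤ FL ({bab, ba3b - ba5} ∪ {p • ga, p • gb}) ⊔
        LieModule.lowerCentralSeries ℤ FL FL 6) :=
    ⟨quotientHom _, quotientHom_surjective _, fun _ => quotientHom_eq_zero⟩
  have hrel (x : FL) (hx : x ∈ ({bab, ba3b - ba5} ∪ {p • ga, p • gb} : Set FL)) : π x = 0 :=
    (hπ _).2 ((le_sup_left : _ ≤ LieSubmodule.lieSpan ℤ FL _ ⊔ _)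
      (LieSubmodule.subset_lieSpan hx))
  obtain ⟨θ, h⟩ := exists_hom_of_relations π hπs (p := p) (hrel _ (by simp)) (hrel _ (by simp))
    (hrel _ (by simp)) (hrel _ (by simp))
    ((hπ _).2 ((le_sup_right : _ ≤ _ ⊔ LieModule.lowerCentralSeries ℤ FL FL 6)
      (leftNormed_mem_lowerCentralSeries ga gb)))
  exact ⟨π, θ, h.1, h.2.1, h.2.2.1, h.2.2.2.1, h.2.2.2.2.1, h.2.2.2.2.2, fun x => (hπ x).1⟩

theorem Models.lieClassEq {L : Type*} [LieRing L] (hp : p.Prime) (h : Models p γ δ L) :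
    LieClassEq L 7 := by
  obtain ⟨φ, hs, hk⟩ := h
  have := Fact.mk hp
  constructor
  · rw [eq_bot_iff]
    intro y hy
    obtain ⟨u, hu, rfl⟩ := exists_mem_lowerCentralSeries φ hs hy
    rw [Cover.eq_of_mem_lowerCentralSeries_seven hu, map_zero]
    exact zero_mem _
  · intro h
    have h6 := map_mem_lowerCentralSeries φ Cover.c₆_mem
    rw [show 7 - 1 = 6 from rfl] at h
    rw [h, LieSubmodule.mem_bot, hk] at h6
    obtain ⟨m, n, hx, hy, -, -, -, -, -, h6⟩ := h6
    have hp0 : (p : ℤ) ≠ 0 := mod_cast hp.ne_zero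
    simp only [Cover.c₆, zero_eq_mul, hp0, false_or] at hx hy
    simp [hx, hy, Cover.c₆] at h6

theorem Models.isLieIso_quotient {L : Type*} [LieRing L] (h : Models p γ δ L) :
    IsLieIso (L ⧸ LieModule.lowerCentralSeries ℤ L L 6) (presLie p {bab, ba3b - ba5}) := by
  obtain ⟨φ, hs, hk⟩ := h
  obtain ⟨π, θ, hθ, ha, hb, hpa, hpb, hc, hπ⟩ := presLie_exists_hom p
  obtain ⟨g, rfl⟩ := ZMod.intCast_surjective γ
  obtain ⟨d, rfl⟩ := ZMod.intCast_surjective δ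
  let q := quotientHom (LieModule.lowerCentralSeries ℤ L L 6)
  have hq : Function.Surjective (q.comp φ) := (quotientHom_surjective _).comp hs
  have hc6 : q (φ Cover.c₆) = 0 :=
    quotientHom_eq_zero.2 (map_mem_lowerCentralSeries φ Cover.c₆_mem)
  refine isLieIso_of_ker_eq (q.comp φ) θ hq hθ fun u => ⟨fun hu => ?_, fun hu => ?_⟩
  · obtain ⟨v, hv, hvu⟩ := exists_mem_lowerCentralSeries φ hs (quotientHom_eq_zero.1 hu)
    have huv : θ (u - v) = 0 := by
      apply hom_eq_zero_of_mem θ (p := p) (g := g) (d := d) (by simp [hpa, hc]) (by simp [hpb, hc])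
      rw [← hk, map_sub, hvu]
      exact sub_self _
    rw [Cover.eq_of_mem_lowerCentralSeries_six hv, map_sub, map_zsmul, hc] at huv
    simpa using huv
  · obtain ⟨f, hfa, hfb⟩ := freeLie_exists_hom (q (φ Cover.a)) (q (φ Cover.b))
    have hker : (LieSubmodule.lieSpan ℤ FL ({bab, ba3b - ba5} ∪ {p • ga, p • gb}) ⊔
        LieModule.lowerCentralSeries ℤ FL FL 6) ≤ f.ker := by
      refine sup_le (LieSubmodule.lieSpan_le.2 ?_) ?_
      · have h1 : f bab = 0 := by
          simp only [bab, LieHom.map_lie, hfa, hfb]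
          simp only [← LieHom.map_lie, Cover.lie_b_a, Cover.lie_c₁_b, map_zero]
        have h2 : f (ba3b - ba5) = 0 := by
          simp only [ba3b, ba5, ba4, ba3, map_sub, LieHom.map_lie, hfa, hfb]
          simp only [← LieHom.map_lie, Cover.lie_b_a, Cover.lie_c₁_a, Cover.lie_c₂_a,
            Cover.lie_c₃_a, Cover.lie_c₄_a, Cover.lie_c₃_b, sub_self]
        have h3 : f (p • ga) = 0 := by
          have : φ ((p : ℤ) • Cover.a - g • Cover.c₆) = 0 :=
            (hk _).2 ⟨1, 0, by simp [Cover.nsmul_def, Cover.zsmul_def, Cover.sub_def, Cover.a, Cover.c₆]⟩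
          rw [map_sub, sub_eq_zero, map_zsmul, map_zsmul] at this
          rw [map_nsmul, hfa, ← natCast_zsmul, ← map_zsmul, this, map_zsmul, hc6, smul_zero]
        have h4 : f (p • gb) = 0 := by
          have : φ ((p : ℤ) • Cover.b - d • Cover.c₆) = 0 :=
            (hk _).2 ⟨0, 1, by simp [Cover.nsmul_def, Cover.zsmul_def, Cover.sub_def, Cover.b, Cover.c₆]⟩
          rw [map_sub, sub_eq_zero, map_zsmul, map_zsmul] at this
          rw [map_nsmul, hfb, ← natCast_zsmul, ← map_zsmul, this, map_zsmul, hc6, smul_zero]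
        rintro x ((rfl | rfl) | (rfl | rfl))
        exacts [h1, h2, h3, h4]
      · intro x hx
        obtain ⟨y, hy, hyx⟩ := exists_mem_lowerCentralSeries q (quotientHom_surjective _)
          (map_mem_lowerCentralSeries f hx)
        rw [LieHom.mem_ker, ← hyx]
        exact quotientHom_eq_zero.2 hy
    have := hker (hπ _ ((map_coverLift π θ ha.symm hb.symm u).trans hu))
    rw [LieHom.mem_ker, map_coverLift f (q.comp φ) hfa hfb] at this
    exact this

theorem natCard_quotient_relIdeal (hp : p.Prime) : Nat.card (Cover ⧸ relIdeal p γ δ) = p ^ 8 := by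
  have := Fact.mk hp
  have hp0 : (p : ℤ) ≠ 0 := mod_cast hp.ne_zero
  let s (v : Fin 8 → ZMod p) : Cover :=
    ⟨(v 0).val, (v 1).val, (v 2).val, (v 3).val, (v 4).val, (v 5).val, (v 6).val, (v 7).val⟩
  have hs : Function.Bijective fun v => quotientHom (relIdeal p γ δ) (s v) := by
    constructor
    · intro v w hvw
      simp only at hvw
      rw [← sub_eq_zero, ← map_sub, quotientHom_eq_zero] at hvw
      obtain ⟨m, n, hx, hy, h1, h2, h3, h4, h5, h6⟩ := hvw
      have key (i : Fin 8) (h : (p : ℤ) ∣ ((v i).val : ℤ) - (w i).val) : v i = w i := by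
        have := (ZMod.intCast_zmod_eq_zero_iff_dvd _ p).2 h
        simpa [sub_eq_zero] using this
      have e0 := key 0 ⟨m, hx⟩
      have e1 := key 1 ⟨n, hy⟩
      simp only [Cover.sub_def, s, e0, e1, sub_self, zero_eq_mul, hp0, false_or] at hx hy
      simp [Cover.sub_def, s, hx, hy, sub_eq_zero] at h6
      ext i
      fin_cases i
      exacts [e0, e1, key 2 h1, key 3 h2, key 4 h3, key 5 h4, key 6 h5, h6]
    · intro z
      obtain ⟨u, rfl⟩ := quotientHom_surjective _ z
      have key (t : ℤ) : (p : ℤ) ∣ (t : ZMod p).val - t := by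
        rw [← ZMod.intCast_zmod_eq_zero_iff_dvd]
        simp
      obtain ⟨m, hm⟩ := key u.x
      obtain ⟨n, hn⟩ := key u.y
      refine ⟨![u.x, u.y, u.t₁, u.t₂, u.t₃, u.t₄, u.t₅, u.t₆ - γ * m - δ * n], ?_⟩
      simp only
      rw [← sub_eq_zero, ← map_sub, quotientHom_eq_zero]
      refine ⟨m, n, hm, hn, key _, key _, key _, key _, key _, ?_⟩
      simp [Cover.sub_def, s]
      ring
  rw [← Nat.card_eq_of_bijective _ hs]
  simp [Nat.card_eq_fintype_card]

theorem Models.of_isLieIso {L M : Type*} [LieRing L] [LieRing M] (h : Models p γ δ L)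
    (e : IsLieIso L M) : Models p γ δ M := by
  obtain ⟨φ, hs, hk⟩ := h
  obtain ⟨f, hf⟩ := e.exists_hom
  exact ⟨f.comp φ, hf.2.comp hs, fun u => by
    rw [← hk, LieHom.comp_apply, map_eq_zero_iff f hf.1]⟩

theorem Models.isLieIso {L M : Type*} [LieRing L] [LieRing M] (h : Models p γ δ L)
    (h' : Models p γ δ M) : IsLieIso L M := by
  obtain ⟨φ, hs, hk⟩ := h
  obtain ⟨φ', hs', hk'⟩ := h'
  exact isLieIso_of_ker_eq φ φ' hs hs' fun u => by rw [hk, hk']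

theorem exists_models (hp : p.Prime) (γ δ : ZMod p) :
    ∃ s : LieRing (Fin (p ^ 8)), @Models p γ δ (Fin (p ^ 8)) s := by
  have : Finite (Cover ⧸ relIdeal p γ δ) := Nat.finite_of_card_ne_zero
    (by rw [natCard_quotient_relIdeal hp]; exact pow_ne_zero _ hp.ne_zero)
  let e : Fin (p ^ 8) ≃ Cover ⧸ relIdeal p γ δ :=
    (Finite.equivFinOfCardEq (natCard_quotient_relIdeal hp)).symm
  let s : LieRing (Fin (p ^ 8)) :=
    { e.addCommGroup with
      bracket := fun x y => e.symm ⁅e x, e y⁆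
      add_lie := fun x y z => by
        apply e.injective
        change e (e.symm ⁅e (e.symm (e x + e y)), e z⁆) =
          e (e.symm (e (e.symm ⁅e x, e z⁆) + e (e.symm ⁅e y, e z⁆)))
        simp
      lie_add := fun x y z => by
        apply e.injective
        change e (e.symm ⁅e x, e (e.symm (e y + e z))⁆) =
          e (e.symm (e (e.symm ⁅e x, e y⁆) + e (e.symm ⁅e x, e z⁆)))
        simp
      lie_self := fun x => by
        change e.symm ⁅e x, e x⁆ = e.symm 0
        simp
      leibniz_lie := fun x y z => by
        apply e.injective
        change e (e.symm ⁅e x, e (e.symm ⁅e y, e z⁆)⁆) =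
          e (e.symm (e (e.symm ⁅e (e.symm ⁅e x, e y⁆), e z⁆) +
            e (e.symm ⁅e y, e (e.symm ⁅e x, e z⁆)⁆)))
        simp }
  refine ⟨s, Models.of_isLieIso (L := Cover ⧸ relIdeal p γ δ)
    ⟨quotientHom _, quotientHom_surjective _, fun u => quotientHom_eq_zero⟩
    ⟨e.symm, fun x y => ?_, fun x y => ?_⟩⟩
  · change _ = e.symm (e (e.symm x) + e (e.symm y))
    simp
  · change _ = e.symm ⁅e (e.symm x), e (e.symm y)⁆
    simp

end Models

section Descendants

variable {p : ℕ} {L : Type*} [LieRing L]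

theorem NearRel.exists_surjective_hom {a b c₁ c₂ c₃ c₄ c₅ c₆ : L} {α β g d r s : ℤ}
    (h : NearRel a b c₁ c₂ c₃ c₄ c₅ c₆ (α • c₆) (β • c₆)) (hα : (3 * s) • c₆ = -(α • c₆))
    (hβ : (3 * r) • c₆ = β • c₆) (ha : (p : ℤ) • a = g • c₆) (hb : (p : ℤ) • b = d • c₆)
    (hspan : ∀ x : L, ∃ u : Cover, x = u.x • a + u.y • b + u.t₁ • c₁ + u.t₂ • c₂ + u.t₃ • c₃ +
      u.t₄ • c₄ + u.t₅ • c₅ + u.t₆ • c₆) :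
    ∃ φ : Cover →ₗ⁅ℤ⁆ L, Function.Surjective φ ∧
      (p : ℤ) • φ Cover.a = (g + r * d) • φ Cover.c₆ ∧ (p : ℤ) • φ Cover.b = d • φ Cover.c₆ := by
  have e (x y z : L) (e : ⁅x, y⁆ = z) : ⁅y, x⁆ = -z := by rw [← lie_skew, e]
  have hc6 (x : L) : ⁅x, c₆⁆ = 0 := by rw [← lie_skew, h.hc₆, neg_zero]
  have hpc3 : (p : ℤ) • c₃ = 0 := by
    rw [← h.h2a, ← h.h1a, ← h.ba, ← smul_lie, ← smul_lie, ← lie_smul, ha, lie_smul, hc6]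
    simp
  have h' : NearRel (a + r • b) (b + s • c₃) (c₁ + s • c₄ + (r * s) • (c₅ + β • c₆))
      (c₂ + s • c₅ + (r * α + 3 * r * s) • c₆) (c₃ + s • c₆) (c₄ + r • (c₅ + β • c₆))
      (c₅ + (3 * r) • c₆) c₆ 0 0 := by
    refine ⟨?_, ?_, ?_, ?_, ?_, ?_, ?_, ?_, h.hc₆, fun _ => zero_lie _, fun _ => zero_lie _⟩ <;>
    simp only [lie_add, add_lie, smul_lie, lie_smul, lie_self, h.ba, h.h1a, h.h2a, h.h3a, h.h4a,
      h.h5a, h.h1b, h.h2b, h.h3b, h.h4b, h.h5b, h.h43, h.h53, h.hc₆, e _ _ _ h.h31]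
    · module
    · module
    · module
    · module
    · module
    · module
    · linear_combination (norm := module) hα
    · linear_combination (norm := module) -hβ
  obtain ⟨φ, h1, h2⟩ := h'.exists_hom
  have e1 := (congrArg φ Cover.lie_b_a).symm
  rw [LieHom.map_lie, h2, h1, h'.ba] at e1
  have e2 := (congrArg φ Cover.lie_c₁_a).symm
  rw [LieHom.map_lie, e1, h1, h'.h1a] at e2
  have e3 := (congrArg φ Cover.lie_c₂_a).symm
  rw [LieHom.map_lie, e2, h1, h'.h2a] at e3
  have e4 := (congrArg φ Cover.lie_c₃_a).symm
  rw [LieHom.map_lie, e3, h1, h'.h3a] at e4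
  have e5 := (congrArg φ Cover.lie_c₄_a).symm
  rw [LieHom.map_lie, e4, h1, h'.h4a] at e5
  have e6 := (congrArg φ Cover.lie_c₅_a).symm
  rw [LieHom.map_lie, e5, h1, h'.h5a] at e6
  refine ⟨φ, fun x => ?_, ?_, ?_⟩
  · let H := φ.range
    have m (v : Cover) (x : L) (hv : φ v = x) : x ∈ H := ⟨v, hv⟩
    have sm (n : ℤ) (x : L) (hx : x ∈ H) : n • x ∈ H := zsmul_mem hx n
    have m6 := m _ _ e6
    have m5 : c₅ ∈ H := by simpa using sub_mem (m _ _ e5) (sm (3 * r) _ m6)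
    have m4 : c₄ ∈ H := by
      simpa using sub_mem (m _ _ e4) (sm r _ (add_mem m5 (sm β _ m6)))
    have m3 : c₃ ∈ H := by simpa using sub_mem (m _ _ e3) (sm s _ m6)
    have m2 : c₂ ∈ H := by
      simpa using sub_mem (sub_mem (m _ _ e2) (sm (r * α + 3 * r * s) _ m6)) (sm s _ m5)
    have m1 : c₁ ∈ H := by
      simpa using sub_mem (sub_mem (m _ _ e1) (sm (r * s) _ (add_mem m5 (sm β _ m6)))) (sm s _ m4)
    have mb : b ∈ H := by simpa using sub_mem (m _ _ h2) (sm s _ m3)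
    have ma : a ∈ H := by simpa using sub_mem (m _ _ h1) (sm r _ mb)
    obtain ⟨u, rfl⟩ := hspan x
    exact (LieHom.mem_range _ _).1 (add_mem (add_mem (add_mem (add_mem (add_mem (add_mem (add_mem
      (sm _ _ ma) (sm _ _ mb)) (sm _ _ m1)) (sm _ _ m2)) (sm _ _ m3)) (sm _ _ m4)) (sm _ _ m5))
      (sm _ _ m6))
  · rw [h1, e6, smul_add, ha, smul_comm, hb]
    module
  · rw [h2, e6, smul_add, hb, smul_comm, hpc3]
    module

theorem models_of_hom (hp : p.Prime) (hcard : Nat.card L = p ^ 8) {g d : ℤ}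
    (φ : Cover →ₗ⁅ℤ⁆ L) (hφ : Function.Surjective φ) (ha : (p : ℤ) • φ Cover.a = g • φ Cover.c₆)
    (hb : (p : ℤ) • φ Cover.b = d • φ Cover.c₆) : Models p (g : ZMod p) (d : ZMod p) L := by
  have hcard' := natCard_quotient_relIdeal (γ := (g : ZMod p)) (δ := d) hp
  have : Finite (Cover ⧸ relIdeal p (g : ZMod p) d) := Nat.finite_of_card_ne_zero
    (by rw [hcard']; exact pow_ne_zero _ hp.ne_zero)
  refine ⟨φ, hφ, fun u => ⟨fun hu => ?_, hom_eq_zero_of_mem φ ha hb⟩⟩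
  let q := quotientHom (relIdeal p (g : ZMod p) d)
  have hq : Function.Surjective q := quotientHom_surjective _
  have key (u v : Cover) (h : q u = q v) : φ u = φ v := by
    rw [← sub_eq_zero, ← map_sub] at h ⊢
    exact hom_eq_zero_of_mem φ ha hb (quotientHom_eq_zero.1 h)
  let f (z : Cover ⧸ relIdeal p (g : ZMod p) d) : L := φ (Function.surjInv hq z)
  have hf (u : Cover) : f (q u) = φ u := key _ _ (Function.surjInv_eq hq _)
  have hfs : Function.Surjective f := fun y => by
    obtain ⟨u, rfl⟩ := hφ y
    exact ⟨q u, hf u⟩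
  have hfb := (Nat.bijective_iff_surjective_and_card f).2 ⟨hfs, hcard'.trans hcard.symm⟩
  refine quotientHom_eq_zero.1 (hfb.1 ?_)
  change f (q u) = f 0
  rw [← map_zero q, hf, hf, hu, map_zero]

theorem exists_models_of_surjective {M : Type*} [LieRing M] (hp : p.Prime) (h5 : 5 ≤ p)
    (hcard : Nat.card L = p ^ 8) (hL : LieModule.lowerCentralSeries ℤ L L 7 = ⊥)
    (π : L →ₗ⁅ℤ⁆ M) (hπ : Function.Surjective π)
    (hker : ∀ x, π x = 0 ↔ x ∈ LieModule.lowerCentralSeries ℤ L L 6)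
    (θ : Cover →ₗ⁅ℤ⁆ M) (hθ : Function.Surjective θ) (ha : (p : ℤ) • θ Cover.a = 0)
    (hb : (p : ℤ) • θ Cover.b = 0) (hc : θ Cover.c₆ = 0) : ∃ γ δ, Models p γ δ L := by
  have hcent (z : L) (hz : π z = 0) (x : L) : ⁅z, x⁆ = 0 := by
    have := lie_mem_lowerCentralSeries ((hker z).1 hz) x
    rwa [hL, LieSubmodule.mem_bot] at this
  obtain ⟨a, haθ⟩ := hπ (θ Cover.a)
  obtain ⟨b, hbθ⟩ := hπ (θ Cover.b)
  obtain ⟨c₁, h1⟩ : ∃ c, ⁅b, a⁆ = c := ⟨_, rfl⟩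
  obtain ⟨c₂, h2⟩ : ∃ c, ⁅c₁, a⁆ = c := ⟨_, rfl⟩
  obtain ⟨c₃, h3⟩ : ∃ c, ⁅c₂, a⁆ = c := ⟨_, rfl⟩
  obtain ⟨c₄, h4⟩ : ∃ c, ⁅c₃, a⁆ = c := ⟨_, rfl⟩
  obtain ⟨c₅, h5'⟩ : ∃ c, ⁅c₄, a⁆ = c := ⟨_, rfl⟩
  obtain ⟨c₆, h6⟩ : ∃ c, ⁅c₅, a⁆ = c := ⟨_, rfl⟩
  have e1 : π c₁ = θ Cover.c₁ := by rw [← h1, ← Cover.lie_b_a]; simp [haθ, hbθ]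
  have e2 : π c₂ = θ Cover.c₂ := by rw [← h2, ← Cover.lie_c₁_a]; simp [haθ, e1]
  have e3 : π c₃ = θ Cover.c₃ := by rw [← h3, ← Cover.lie_c₂_a]; simp [haθ, e2]
  have e4 : π c₄ = θ Cover.c₄ := by rw [← h4, ← Cover.lie_c₃_a]; simp [haθ, e3]
  have e5 : π c₅ = θ Cover.c₅ := by rw [← h5', ← Cover.lie_c₄_a]; simp [haθ, e4]
  have e6 : π c₆ = 0 := by rw [← hc, ← h6, ← Cover.lie_c₅_a]; simp [haθ, e5]
  have hz₁ : π ⁅c₁, b⁆ = 0 := by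
    rw [LieHom.map_lie, e1, hbθ, ← LieHom.map_lie, Cover.lie_c₁_b, map_zero]
  have hz₂ : π (⁅c₃, b⁆ - c₅) = 0 := by
    rw [map_sub, LieHom.map_lie, e3, hbθ, ← LieHom.map_lie, Cover.lie_c₃_b, e5, sub_self]
  have hrel : NearRel a b c₁ c₂ c₃ c₄ c₅ c₆ ⁅c₁, b⁆ (⁅c₃, b⁆ - c₅) :=
    ⟨h1, h2, h3, h4, h5', h6, rfl, by abel, hcent _ e6, hcent _ hz₁, hcent _ hz₂⟩
  have hspan (x : L) : ∃ (u : Cover) (z : L), π z = 0 ∧ x = u.x • a + u.y • b + u.t₁ • c₁ +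
      u.t₂ • c₂ + u.t₃ • c₃ + u.t₄ • c₄ + u.t₅ • c₅ + z := by
    obtain ⟨u, hu⟩ := hθ (π x)
    refine ⟨u, x - (u.x • a + u.y • b + u.t₁ • c₁ + u.t₂ • c₂ + u.t₃ • c₃ + u.t₄ • c₄ + u.t₅ • c₅),
      ?_, by abel⟩
    rw [map_sub, ← hu, Cover.eq_sum u]
    simp only [map_add, map_zsmul, haθ, hbθ, e1, e2, e3, e4, e5, hc]
    simp [Cover.zsmul_def, Cover.add_def, Cover.a, Cover.b, Cover.c₁, Cover.c₂, Cover.c₃, Cover.c₄,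
      Cover.c₅, Cover.c₆]
  let N : LieIdeal ℤ L :=
    { AddSubgroup.toIntSubmodule (AddSubgroup.zmultiples c₆) with
      lie_mem := by
        rintro x _ ⟨k, rfl⟩
        refine ⟨0, ?_⟩
        simp only [lie_smul, zero_smul]
        rw [← lie_skew, hcent _ e6, neg_zero, smul_zero] }
  have hN : LieModule.lowerCentralSeries ℤ L L 6 ≤ N := by
    rw [LieModule.lowerCentralSeries_succ, LieSubmodule.lie_le_iff]
    intro x _ m hm
    obtain ⟨u, hu, hum⟩ := exists_mem_lowerCentralSeries θ hθ (map_mem_lowerCentralSeries π hm)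
    rw [Cover.eq_of_mem_lowerCentralSeries_five hu, map_add, map_zsmul, map_zsmul, hc, smul_zero,
      add_zero, ← e5, ← map_zsmul, eq_comm, ← sub_eq_zero, ← map_sub] at hum
    obtain ⟨v, z, hz, rfl⟩ := hspan x
    have : ⁅m, v.x • a + v.y • b + v.t₁ • c₁ +
      v.t₂ • c₂ + v.t₃ • c₃ + v.t₄ • c₄ + v.t₅ • c₅ + z⁆ = (u.t₅ * v.x) • c₆ := by
      rw [← sub_add_cancel m (u.t₅ • c₅), add_lie, hcent _ hum, smul_lie, zero_add]
      simp only [lie_add, lie_smul, hrel.h5a, hrel.h5b, hrel.h51, hrel.h52, hrel.h53, hrel.h54,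
        lie_self, smul_zero, add_zero]
      rw [← lie_skew c₅ z, hcent z hz]
      module
    rw [← lie_skew, this]
    exact neg_mem ⟨_, rfl⟩
  have hZ (z : L) (hz : π z = 0) : ∃ k : ℤ, z = k • c₆ := by
    obtain ⟨k, hk⟩ := hN ((hker z).1 hz)
    exact ⟨k, hk.symm⟩
  obtain ⟨α, hα⟩ := hZ _ hz₁
  obtain ⟨β, hβ⟩ := hZ _ hz₂
  obtain ⟨g, hg⟩ := hZ ((p : ℤ) • a) (by rw [map_zsmul, haθ, ha])
  obtain ⟨d, hd⟩ := hZ ((p : ℤ) • b) (by rw [map_zsmul, hbθ, hb])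
  rw [hα, hβ] at hrel
  have hpc6 : (p : ℤ) • c₆ = 0 := by
    rw [← h6, ← h5', ← h4, ← h3, ← h2, ← h1, ← smul_lie, ← smul_lie, ← smul_lie, ← smul_lie,
      ← smul_lie, ← lie_smul, hg, lie_smul, ← lie_skew b c₆, hcent _ e6]
    simp
  have hcop : IsCoprime (3 : ℤ) p := by
    rw [show (3 : ℤ) = (3 : ℕ) by rfl, Nat.isCoprime_iff_coprime,
      Nat.coprime_primes Nat.prime_three hp]
    omega
  obtain ⟨m, n, hmn⟩ := hcop
  obtain ⟨φ, hφ, h1, h2⟩ := hrel.exists_surjective_hom (p := p) (r := m * β) (s := m * -α)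
    (by linear_combination (norm := module) (n * α) • hpc6 + (-α) • congrArg (· • c₆) hmn)
    (by linear_combination (norm := module) (-n * β) • hpc6 + β • congrArg (· • c₆) hmn) hg hd
    fun x => by
      obtain ⟨u, z, hz, rfl⟩ := hspan x
      obtain ⟨k, rfl⟩ := hZ z hz
      exact ⟨⟨u.x, u.y, u.t₁, u.t₂, u.t₃, u.t₄, u.t₅, k⟩, rfl⟩
  exact ⟨_, _, models_of_hom hp hcard φ hφ h1 h2⟩

theorem exists_models_of_descendant (hp : p.Prime) (h5 : 5 ≤ p) (hcard : Nat.card L = p ^ 8)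
    (hL : LieClassEq L 7)
    (hq : IsLieIso (L ⧸ LieModule.lowerCentralSeries ℤ L L 6) (presLie p {bab, ba3b - ba5})) :
    ∃ γ δ, Models p γ δ L := by
  obtain ⟨f, hf⟩ := hq.exists_hom
  obtain ⟨-, θ, hθ, -, -, ha, hb, hc, -⟩ := presLie_exists_hom p
  exact exists_models_of_surjective hp h5 hcard hL.1 (f.comp (quotientHom _))
    (hf.2.comp (quotientHom_surjective _))
    (fun x => by rw [LieHom.comp_apply, map_eq_zero_iff f hf.1, quotientHom_eq_zero])
    θ hθ ha hb hc

end Descendants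

section Parameters

variable {p : ℕ} {γ δ γ' δ' : ZMod p} {L : Type*} [LieRing L]

theorem Cover.leftNormed_eq (A B : Cover) : ⁅⁅⁅⁅⁅⁅B, A⁆, A⁆, A⁆, A⁆, A⁆, A⁆ =
    ((B.y * A.x - B.x * A.y) * A.x ^ 5) • c₆ := by
  ext <;> simp only [lie_def, zsmul_def, c₆] <;> ring

theorem intCast_coords_eq_zero {u : Cover} (hu : u ∈ relIdeal p γ δ) (hx : u.x = 0) (hy : u.y = 0)
    (hp : p.Prime) : (u.t₂ : ZMod p) = 0 ∧ (u.t₅ : ZMod p) = 0 ∧ (u.t₆ : ZMod p) = 0 := by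
  obtain ⟨m, n, hm, hn, -, h2, -, -, h5, h6⟩ := hu
  have hp0 : (p : ℤ) ≠ 0 := mod_cast hp.ne_zero
  simp only [hx, hy, zero_eq_mul, hp0, false_or] at hm hn
  exact ⟨(ZMod.intCast_zmod_eq_zero_iff_dvd _ p).2 h2, (ZMod.intCast_zmod_eq_zero_iff_dvd _ p).2 h5,
    by simpa [hm, hn] using h6⟩

theorem mul_eq_of_mem_relIdeal {A : Cover} {k : ℤ} (hp : p.Prime)
    (h : (p : ℤ) • A - k • Cover.c₆ ∈ relIdeal p γ δ) :
    γ * (A.x : ZMod p) + δ * (A.y : ZMod p) = k := by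
  obtain ⟨m, n, hm, hn, -, -, -, -, -, h6⟩ := h
  have hp0 : (p : ℤ) ≠ 0 := mod_cast hp.ne_zero
  simp only [Cover.sub_def, Cover.zsmul_def, Cover.c₆, mul_zero, sub_zero, mul_eq_mul_left_iff, hp0,
    or_false] at hm hn h6
  rw [← hm, ← hn] at h6
  push_cast at h6
  rw [CharP.cast_eq_zero] at h6
  linear_combination h6

theorem Models.exists_unit (hp : p.Prime) (h5 : 5 ≤ p) (h : Models p γ δ L)
    (h' : Models p γ' δ' L) : ∃ u : (ZMod p)ˣ, γ = u ^ 7 * γ' ∧ δ = u ^ 6 * δ' := by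
  have := Fact.mk hp
  obtain ⟨φ, hs, hk⟩ := h
  obtain ⟨φ', hs', hk'⟩ := h'
  obtain ⟨A, hA⟩ := hs (φ' Cover.a)
  obtain ⟨B, hB⟩ := hs (φ' Cover.b)
  have hC : φ ⁅⁅⁅⁅⁅⁅B, A⁆, A⁆, A⁆, A⁆, A⁆, A⁆ = φ' Cover.c₆ := by
    rw [← Cover.lie_c₅_a, ← Cover.lie_c₄_a, ← Cover.lie_c₃_a, ← Cover.lie_c₂_a, ← Cover.lie_c₁_a,
      ← Cover.lie_b_a]
    simp only [LieHom.map_lie, hA, hB]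
  rw [Cover.leftNormed_eq] at hC
  have hR1 : φ ⁅⁅B, A⁆, B⁆ = 0 := by
    rw [← map_zero φ', ← Cover.lie_c₁_b, ← Cover.lie_b_a]
    simp only [LieHom.map_lie, hA, hB]
  have hR3 : φ (⁅⁅⁅⁅B, A⁆, A⁆, A⁆, B⁆ - ⁅⁅⁅⁅⁅B, A⁆, A⁆, A⁆, A⁆, A⁆) = 0 := by
    rw [← map_zero φ', ← sub_eq_zero.2 Cover.lie_c₃_b, ← Cover.lie_c₄_a, ← Cover.lie_c₃_a,
      ← Cover.lie_c₂_a, ← Cover.lie_c₁_a, ← Cover.lie_b_a]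
    simp only [LieHom.map_lie, map_sub, hA, hB]
  have hc6 : ((((B.y * A.x - B.x * A.y) * A.x ^ 5 : ℤ) : ZMod p)) ≠ 0 := by
    intro h0
    have h6 : φ (((B.y * A.x - B.x * A.y) * A.x ^ 5) • Cover.c₆) = 0 :=
      (hk _).2 ⟨0, 0, by simpa [Cover.zsmul_def, Cover.c₆] using h0⟩
    rw [hC, hk'] at h6
    simpa [Cover.c₆] using (intCast_coords_eq_zero h6 rfl rfl hp).2.2
  obtain ⟨g, rfl⟩ := ZMod.intCast_surjective γ'
  obtain ⟨d, rfl⟩ := ZMod.intCast_surjective δ'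
  have hγ := mul_eq_of_mem_relIdeal (γ := γ) (δ := δ) hp (A := A)
    (k := g * ((B.y * A.x - B.x * A.y) * A.x ^ 5)) (by
      rw [← hk, map_sub, map_zsmul, hA, mul_smul, map_zsmul, hC, ← map_zsmul, ← map_zsmul,
        ← map_sub, hk']
      exact ⟨1, 0, by simp [Cover.sub_def, Cover.nsmul_def, Cover.zsmul_def, Cover.a, Cover.c₆]⟩)
  have hδ := mul_eq_of_mem_relIdeal (γ := γ) (δ := δ) hp (A := B)
    (k := d * ((B.y * A.x - B.x * A.y) * A.x ^ 5)) (by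
      rw [← hk, map_sub, map_zsmul, hB, mul_smul, map_zsmul, hC, ← map_zsmul, ← map_zsmul,
        ← map_sub, hk']
      exact ⟨0, 1, by simp [Cover.sub_def, Cover.nsmul_def, Cover.zsmul_def, Cover.b, Cover.c₆]⟩)
  have e1 := (intCast_coords_eq_zero ((hk _).1 hR1) rfl rfl hp).1
  obtain ⟨-, e2, e3⟩ := intCast_coords_eq_zero ((hk _).1 hR3) rfl rfl hp
  simp only [Cover.lie_def, Cover.sub_def] at e1 e2 e3
  push_cast at e1 e2 e3 hc6 hγ hδ
  generalize (A.x : ZMod p) = u, (A.y : ZMod p) = r, (B.x : ZMod p) = s, (B.y : ZMod p) = v at *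
  have hu : u ≠ 0 := by rintro rfl; simp at hc6
  have hD : v * u - s * r ≠ 0 := left_ne_zero_of_mul hc6
  have hs0 : s = 0 := by
    have : (v * u - s * r) * s = 0 := by linear_combination e1
    exact (mul_eq_zero.1 this).resolve_left hD
  subst hs0
  have hv : v = u ^ 2 := by
    have : (v * u - 0 * r) * u ^ 2 * (v - u ^ 2) = 0 := by linear_combination e2
    exact sub_eq_zero.1 ((mul_eq_zero.1 this).resolve_left (mul_ne_zero hD (pow_ne_zero 2 hu)))
  subst hv
  have h3 : (3 : ZMod p) ≠ 0 := by
    intro h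
    have := (ZMod.natCast_eq_zero_iff 3 p).1 (mod_cast h)
    have := Nat.le_of_dvd (by norm_num) this
    omega
  have hr : r = 0 := by
    have : 3 * u ^ 6 * r = 0 := by linear_combination -e3
    exact (mul_eq_zero.1 this).resolve_left (mul_ne_zero h3 (pow_ne_zero 6 hu))
  subst hr
  refine ⟨Units.mk0 u hu, mul_left_cancel₀ hu ?_, mul_left_cancel₀ (pow_ne_zero 2 hu) ?_⟩
  · rw [Units.val_mk0]
    linear_combination hγ
  · rw [Units.val_mk0]
    linear_combination hδ

theorem Cover.nearRel_smul (U : ℤ) : NearRel (U • a) (U ^ 2 • b) (U ^ 3 • c₁) (U ^ 4 • c₂)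
    (U ^ 5 • c₃) (U ^ 6 • c₄) (U ^ 7 • c₅) (U ^ 8 • c₆) 0 0 := by
  constructor
  all_goals
    intros
    ext <;> simp [lie_def, zsmul_def, add_def, zero_def, a, b, c₁, c₂, c₃, c₄, c₅, c₆] <;> ring

theorem Models.smul (hp : p.Prime) (hcard : Nat.card L = p ^ 8) (u : (ZMod p)ˣ)
    (h : Models p (u ^ 7 * γ') (u ^ 6 * δ') L) : Models p γ' δ' L := by
  have := Fact.mk hp
  obtain ⟨φ, hs, hk⟩ := h
  obtain ⟨U, hU⟩ := ZMod.intCast_surjective (u : ZMod p)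
  obtain ⟨g, rfl⟩ := ZMod.intCast_surjective γ'
  obtain ⟨d, rfl⟩ := ZMod.intCast_surjective δ'
  obtain ⟨ψ, ha, hb⟩ := (Cover.nearRel_smul U).exists_hom
  have hc : ψ Cover.c₆ = U ^ 8 • Cover.c₆ := by
    have h := Cover.nearRel_smul U
    rw [← h.h5a, ← h.h4a, ← h.h3a, ← h.h2a, ← h.h1a, ← h.ba, ← ha, ← hb]
    simp only [← LieHom.map_lie]
    rw [Cover.lie_b_a, Cover.lie_c₁_a, Cover.lie_c₂_a, Cover.lie_c₃_a, Cover.lie_c₄_a,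
      Cover.lie_c₅_a]
  have hcop : IsCoprime U ((p : ℤ) ^ 2) := by
    apply IsCoprime.pow_right
    rw [isCoprime_comm, Prime.coprime_iff_not_dvd (Nat.prime_iff_prime_int.1 hp),
      ← ZMod.intCast_zmod_eq_zero_iff_dvd, hU]
    exact u.ne_zero
  have hpp (w : Cover) : ((p : ℤ) ^ 2) • φ w = 0 := by
    rw [← map_zsmul, hk]
    refine ⟨p * w.x, p * w.y, ?_⟩
    simp only [Cover.zsmul_def]
    refine ⟨by ring, by ring, ⟨p * w.t₁, by ring⟩, ⟨p * w.t₂, by ring⟩, ⟨p * w.t₃, by ring⟩,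
      ⟨p * w.t₄, by ring⟩, ⟨p * w.t₅, by ring⟩, by simp⟩
  have hdiv (k : ℕ) (w : Cover) (hw : U ^ k • φ w ∈ (φ.comp ψ).range) :
      φ w ∈ (φ.comp ψ).range := by
    obtain ⟨m, n, hmn⟩ := hcop.pow_left (m := k)
    have : φ w = m • U ^ k • φ w := by
      linear_combination (norm := module) (-1 : ℤ) • congrArg (· • φ w) hmn + n • hpp w
    rw [this]
    exact zsmul_mem hw m
  have mem (w : Cover) : φ (ψ w) ∈ (φ.comp ψ).range := ⟨w, rfl⟩
  have ma : φ Cover.a ∈ (φ.comp ψ).range :=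
    hdiv 1 _ (by rw [pow_one, ← map_zsmul, ← ha]; exact mem _)
  have mb : φ Cover.b ∈ (φ.comp ψ).range := hdiv 2 _ (by rw [← map_zsmul, ← hb]; exact mem _)
  refine models_of_hom hp hcard (φ.comp ψ) (fun y => ?_) ?_ ?_
  · obtain ⟨w, rfl⟩ := hs y
    have m1 : φ Cover.c₁ ∈ (φ.comp ψ).range := by
      rw [← Cover.lie_b_a, LieHom.map_lie]; exact LieSubalgebra.lie_mem _ mb ma
    have m2 : φ Cover.c₂ ∈ (φ.comp ψ).range := by
      rw [← Cover.lie_c₁_a, LieHom.map_lie]; exact LieSubalgebra.lie_mem _ m1 ma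
    have m3 : φ Cover.c₃ ∈ (φ.comp ψ).range := by
      rw [← Cover.lie_c₂_a, LieHom.map_lie]; exact LieSubalgebra.lie_mem _ m2 ma
    have m4 : φ Cover.c₄ ∈ (φ.comp ψ).range := by
      rw [← Cover.lie_c₃_a, LieHom.map_lie]; exact LieSubalgebra.lie_mem _ m3 ma
    have m5 : φ Cover.c₅ ∈ (φ.comp ψ).range := by
      rw [← Cover.lie_c₄_a, LieHom.map_lie]; exact LieSubalgebra.lie_mem _ m4 ma
    have m6 : φ Cover.c₆ ∈ (φ.comp ψ).range := by
      rw [← Cover.lie_c₅_a, LieHom.map_lie]; exact LieSubalgebra.lie_mem _ m5 ma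
    rw [Cover.eq_sum w]
    simp only [map_add, map_zsmul]
    exact (LieHom.mem_range _ _).1 (add_mem (add_mem (add_mem (add_mem (add_mem (add_mem (add_mem
      (zsmul_mem ma _) (zsmul_mem mb _)) (zsmul_mem m1 _)) (zsmul_mem m2 _)) (zsmul_mem m3 _))
      (zsmul_mem m4 _)) (zsmul_mem m5 _)) (zsmul_mem m6 _))
  · rw [LieHom.comp_apply, LieHom.comp_apply, ha, hc, ← map_zsmul, ← map_zsmul, ← sub_eq_zero,
      ← map_sub, hk]
    refine ⟨U, 0, ?_⟩
    simp [Cover.sub_def, Cover.nsmul_def, Cover.zsmul_def, Cover.a, Cover.c₆, hU]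
    ring
  · rw [LieHom.comp_apply, LieHom.comp_apply, hb, hc, ← map_zsmul, ← map_zsmul, ← sub_eq_zero,
      ← map_sub, hk]
    refine ⟨0, U ^ 2, ?_⟩
    simp [Cover.sub_def, Cover.nsmul_def, Cover.zsmul_def, Cover.b, Cover.c₆, hU]
    ring

end Parameters

section Counting

/-- If isomorphism classes of `S` are parametrised by the orbits of a group action, they are counted
by the orbits. -/
theorem natCard_quot_eq_natCard_orbits {S P G : Type*} [Group G] [MulAction G P] (R : S → S → Prop)
    (mod : P → S → Prop) (exists_left : ∀ P, ∃ s, mod P s) (exists_right : ∀ s, ∃ P, mod P s)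
    (rel_of_mod : ∀ {P s t}, mod P s → mod P t → R s t)
    (mod_of_rel : ∀ {P s t}, mod P s → R s t → mod P t)
    (orbit_of_mod : ∀ {P Q s}, mod P s → mod Q s → P ∈ MulAction.orbit G Q)
    (mod_of_orbit : ∀ {P Q s}, mod P s → P ∈ MulAction.orbit G Q → mod Q s) :
    Nat.card (Quot R) = Nat.card (Quotient (MulAction.orbitRel G P)) := by
  choose f hf using exists_right
  let F : Quot R → Quotient (MulAction.orbitRel G P) :=
    Quot.lift (fun s => Quotient.mk _ (f s)) fun s t hst =>
      Quotient.sound (orbit_of_mod (mod_of_rel (hf s) hst) (hf t))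
  refine Nat.card_eq_of_bijective F ⟨?_, ?_⟩
  · rintro ⟨s⟩ ⟨t⟩ hst
    exact Quot.sound (rel_of_mod (mod_of_orbit (hf s) (Quotient.exact hst)) (hf t))
  · rintro ⟨P⟩
    obtain ⟨s, hs⟩ := exists_left P
    exact ⟨Quot.mk _ s, Quotient.sound (orbit_of_mod (hf s) hs)⟩

/-- The parameters `(γ, δ)` of a descendant. -/
def Params (p : ℕ) : Type := ZMod p × ZMod p

variable {p : ℕ}

instance : MulAction (ZMod p)ˣ (Params p) where
  smul u P := (u ^ 7 * P.1, u ^ 6 * P.2)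
  one_smul P := by
    change (((1 : (ZMod p)ˣ) : ZMod p) ^ 7 * P.1, ((1 : (ZMod p)ˣ) : ZMod p) ^ 6 * P.2) = P
    simp only [Units.val_one, one_pow, one_mul]
    rfl
  mul_smul u v P := by
    change (((u * v : (ZMod p)ˣ) : ZMod p) ^ 7 * P.1, ((u * v : (ZMod p)ˣ) : ZMod p) ^ 6 * P.2) =
      ((u : ZMod p) ^ 7 * ((v : ZMod p) ^ 7 * P.1), (u : ZMod p) ^ 6 * ((v : ZMod p) ^ 6 * P.2))
    simp only [Units.val_mul, mul_pow, mul_assoc]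

theorem Params.smul_def (u : (ZMod p)ˣ) (P : Params p) :
    u • P = ((u : ZMod p) ^ 7 * P.1, (u : ZMod p) ^ 6 * P.2) := rfl

theorem natCard_mul_eq_self [Fact p.Prime] (u : (ZMod p)ˣ) :
    Nat.card {x : ZMod p // u * x = x} = if u = 1 then p else 1 := by
  split_ifs with h
  · simp [h]
  · have (x : ZMod p) : u * x = x ↔ x = 0 := by
      refine ⟨fun hx => ?_, fun hx => by simp [hx]⟩
      have : ((u : ZMod p) - 1) * x = 0 := by linear_combination hx
      refine (mul_eq_zero.1 this).resolve_left fun h' => h ?_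
      exact Units.ext (sub_eq_zero.1 h')
    simp [this]

theorem natCard_fixedBy [Fact p.Prime] (u : (ZMod p)ˣ) :
    Nat.card (MulAction.fixedBy (Params p) u) =
      (if u ^ 7 = 1 then p else 1) * if u ^ 6 = 1 then p else 1 := by
  rw [← natCard_mul_eq_self, ← natCard_mul_eq_self, ← Nat.card_prod]
  refine Nat.card_congr
    { toFun := fun P => (⟨P.1.1, ?_⟩, ⟨P.1.2, ?_⟩)
      invFun := fun x => ⟨(x.1.1, x.2.1), ?_⟩
      left_inv := fun _ => rfl
      right_inv := fun _ => rfl }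
  · have := congrArg Prod.fst P.2
    rwa [Units.val_pow_eq_pow_val]
  · have := congrArg Prod.snd P.2
    rwa [Units.val_pow_eq_pow_val]
  · exact Prod.ext
      ((congrArg (· * x.1.1) (Units.val_pow_eq_pow_val u 7).symm).trans x.1.2)
      ((congrArg (· * x.2.1) (Units.val_pow_eq_pow_val u 6).symm).trans x.2.2)

theorem sum_ite_pow_eq_one [Fact p.Prime] (k : ℕ) :
    (∑ u : (ZMod p)ˣ, if u ^ k = 1 then 1 else 0) = (p - 1).gcd k := by
  have := IsCyclic.card_powMonoidHom_ker (ZMod p)ˣ k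
  rw [Nat.card_eq_fintype_card (α := (ZMod p)ˣ), ZMod.card_units] at this
  rw [← this, Finset.sum_boole, Nat.cast_id, ← Fintype.card_subtype, ← Nat.card_eq_fintype_card]
  rfl

theorem natCard_orbits (hp : p.Prime) (h5 : 5 ≤ p) :
    Nat.card (Quotient (MulAction.orbitRel (ZMod p)ˣ (Params p))) =
      p + 2 * Nat.gcd (p - 1) 3 + Nat.gcd (p - 1) 7 := by
  classical
  have := Fact.mk hp
  have : Finite (Params p) := inferInstanceAs (Finite (ZMod p × ZMod p))
  have := Fintype.ofFinite (Params p)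
  have := Fintype.ofFinite (Quotient (MulAction.orbitRel (ZMod p)ˣ (Params p)))
  have burnside := MulAction.sum_card_fixedBy_eq_card_orbits_mul_card_group (ZMod p)ˣ (Params p)
  simp only [← Nat.card_eq_fintype_card, natCard_fixedBy] at burnside
  rw [Nat.card_eq_fintype_card (α := (ZMod p)ˣ), ZMod.card_units] at burnside
  obtain ⟨q, rfl⟩ : ∃ q, p = q + 1 := ⟨p - 1, by omega⟩
  have h1 : (∑ u : (ZMod (q + 1))ˣ, if u = 1 then 1 else 0) = 1 := by simp
  have h6 := sum_ite_pow_eq_one (p := q + 1) 6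
  have h7 := sum_ite_pow_eq_one (p := q + 1) 7
  have hterm (u : (ZMod (q + 1))ˣ) :
      ((if u ^ 7 = 1 then q + 1 else 1) * if u ^ 6 = 1 then q + 1 else 1) =
        1 + q * (if u ^ 7 = 1 then 1 else 0) + q * (if u ^ 6 = 1 then 1 else 0) +
          q ^ 2 * (if u = 1 then 1 else 0) := by
    by_cases hu7 : u ^ 7 = 1 <;> by_cases hu6 : u ^ 6 = 1
    · have hu : u = 1 := by rwa [pow_succ, hu6, one_mul] at hu7
      simp [hu]
      ring
    · have hu : u ≠ 1 := by rintro rfl; simp at hu6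
      simp [hu7, hu6, hu]
      ring
    · have hu : u ≠ 1 := by rintro rfl; simp at hu7
      simp [hu7, hu6, hu]
      ring
    · have hu : u ≠ 1 := by rintro rfl; simp at hu7
      simp [hu7, hu6, hu]
  simp only [hterm, Finset.sum_add_distrib, ← Finset.mul_sum, h1, h6, h7, Finset.sum_const,
    Finset.card_univ, ZMod.card_units, smul_eq_mul, mul_one, Nat.add_sub_cancel] at burnside
  have hgcd : q.gcd 6 = 2 * q.gcd 3 := by
    have hodd := hp.eq_two_or_odd
    have : q.gcd 2 = 2 := Nat.gcd_eq_right (by omega)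
    rw [show 6 = 2 * 3 by rfl, Nat.Coprime.gcd_mul q (by norm_num), this]
  have hq : 0 < q := by omega
  refine Nat.eq_of_mul_eq_mul_right hq (burnside.symm.trans ?_)
  rw [hgcd, Nat.add_sub_cancel]
  ring

end Counting

/-- The Lie ring 7.627 : `⟨a,b | [b,a,b], [b,a,a,a,b]-[b,a,a,a,a,a], pa, pb, class 6⟩`
has `p + 2gcd(p-1,3) + gcd(p-1,7)` descendants of order `p^8` (of maximal class 7). -/
theorem descendants_of_7_627 (p : ℕ) (hp : p.Prime) (h5 : 5 ≤ p) :
    Nat.card (Quot (fun s t :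
        {s : LieRing (Fin (p ^ 8)) //
          IsMaxClassDescendantOf p (presLie p {bab, ba3b - ba5}) s} =>
      @IsLieIso _ _ s.1 t.1)) =
    p + 2 * Nat.gcd (p - 1) 3 + Nat.gcd (p - 1) 7 := by
  rw [← natCard_orbits hp h5]
  have hcard : Nat.card (Fin (p ^ 8)) = p ^ 8 := Nat.card_fin _
  refine natCard_quot_eq_natCard_orbits (G := (ZMod p)ˣ) (P := Params p) _
    (fun P s => @Models p P.1 P.2 (Fin (p ^ 8)) s.1) ?_ ?_ ?_ ?_ ?_ ?_
  · intro P
    obtain ⟨s, hs⟩ := exists_models hp P.1 P.2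
    exact ⟨⟨s, @Models.lieClassEq p P.1 P.2 _ s hp hs,
      @Models.isLieIso_quotient p P.1 P.2 _ s hs⟩, hs⟩
  · rintro ⟨s, hL, hq⟩
    obtain ⟨γ, δ, h⟩ := @exists_models_of_descendant p _ s hp h5 hcard hL hq
    exact ⟨(γ, δ), h⟩
  · intro P s t hs ht
    exact @Models.isLieIso p P.1 P.2 _ _ s.1 t.1 hs ht
  · intro P s t hs hst
    exact @Models.of_isLieIso p P.1 P.2 _ _ s.1 t.1 hs hst
  · intro P Q s hP hQ
    obtain ⟨u, h1, h2⟩ := @Models.exists_unit p P.1 P.2 Q.1 Q.2 _ s.1 hp h5 hP hQ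
    exact ⟨u, (Prod.ext h1 h2).symm⟩
  · rintro _ Q s hP ⟨u, rfl⟩
    exact @Models.smul p Q.1 Q.2 _ s.1 hp hcard u hP
end

section
/- Let p ≥ 5 be a prime and let M be the Lie ring ⟨a, b | [b,a,b] − [b,a,a,a,a,a], [b,a,a,a,b], p•a, p•b, class 6⟩, i.e., the quotient of the free Lie ring on generators a, b by the Lie ideal generated by the listed elements together with the 7th term of the lower central series. Then the number of isomorphism classes of Lie rings L of cardinality p^8, nilpotent of class exactly 7, with L/L⁷ ≅ M equals 4p + (p+1)·gcd(p−1,3) + 2·gcd(p−1,9) + gcd(p−1,12). -/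
/-- The carry of the addition of two residues modulo `p`. -/
def zcarry {p : ℕ} (a b : ZMod p) : ZMod p := ((a.val + b.val) / p : ℕ)

/-- Structure constants of a class 7 descendant: `f₁, f₂, x, y, u, v` are the coordinates, with
respect to a generator of the last term, of `[b,a,a,a,a,a,a]`, `[b,a,a,a,a,a,b]`,
`[b,a,b] - [b,a,a,a,a,a]`, `[b,a,a,a,b]`, `pa` and `pb`. -/
structure DescParam (p : ℕ) where
  (f₁ f₂ x y u v : ZMod p)

/-- The model Lie ring with given structure constants, in coordinates. -/
@[ext] structure DescModel {p : ℕ} (θ : DescParam p) where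
  (a b c₂ c₃ c₄ c₅ c₆ z : ZMod p)

section Carry

variable {p : ℕ}

theorem val_add_carry [NeZero p] (a b : ZMod p) :
    (a + b).val + p * ((a.val + b.val) / p) = a.val + b.val := by
  rw [ZMod.val_add]; exact Nat.mod_add_div _ _

theorem zcarry_comm (a b : ZMod p) : zcarry a b = zcarry b a := by
  simp [zcarry, add_comm]

variable [Fact p.Prime]

@[simp] theorem zcarry_zero_left (b : ZMod p) : zcarry 0 b = 0 := by
  simp [zcarry, Nat.div_eq_of_lt (ZMod.val_lt b)]

@[simp] theorem zcarry_zero_right (b : ZMod p) : zcarry b 0 = 0 := by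
  rw [zcarry_comm, zcarry_zero_left]

theorem zcarry_assoc (a b c : ZMod p) :
    zcarry a b + zcarry (a + b) c = zcarry b c + zcarry a (b + c) := by
  have h1 := val_add_carry a b
  have h2 := val_add_carry (a + b) c
  have h3 := val_add_carry b c
  have h4 := val_add_carry a (b + c)
  rw [← add_assoc] at h4
  have hp : 0 < p := (Fact.out : p.Prime).pos
  have : (a.val + b.val) / p + ((a + b).val + c.val) / p
      = (b.val + c.val) / p + (a.val + (b + c).val) / p := by
    apply Nat.eq_of_mul_eq_mul_left hp
    rw [mul_add, mul_add]; omega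
  simp only [zcarry]
  exact_mod_cast congrArg (Nat.cast : ℕ → ZMod p) this

end Carry

namespace DescModel

variable {p : ℕ} {θ : DescParam p}

/-- The model as a product. -/
def equivProd (θ : DescParam p) : DescModel θ ≃
    ZMod p × ZMod p × ZMod p × ZMod p × ZMod p × ZMod p × ZMod p × ZMod p where
  toFun g := (g.a, g.b, g.c₂, g.c₃, g.c₄, g.c₅, g.c₆, g.z)
  invFun t := ⟨t.1, t.2.1, t.2.2.1, t.2.2.2.1, t.2.2.2.2.1, t.2.2.2.2.2.1, t.2.2.2.2.2.2.1,
    t.2.2.2.2.2.2.2⟩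
  left_inv _ := rfl
  right_inv _ := rfl

theorem natCard (θ : DescParam p) : Nat.card (DescModel θ) = p ^ 8 := by
  rw [Nat.card_congr (equivProd θ)]
  simp only [Nat.card_prod, Nat.card_zmod]
  ring

variable [Fact p.Prime]

instance : Zero (DescModel θ) := ⟨⟨0, 0, 0, 0, 0, 0, 0, 0⟩⟩

instance : Add (DescModel θ) := ⟨fun g h => ⟨g.a + h.a, g.b + h.b, g.c₂ + h.c₂, g.c₃ + h.c₃,
  g.c₄ + h.c₄, g.c₅ + h.c₅, g.c₆ + h.c₆,
  g.z + h.z + (θ.u * zcarry g.a h.a + θ.v * zcarry g.b h.b)⟩⟩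

instance : Neg (DescModel θ) := ⟨fun g => ⟨-g.a, -g.b, -g.c₂, -g.c₃, -g.c₄, -g.c₅, -g.c₆,
  -g.z - (θ.u * zcarry (-g.a) g.a + θ.v * zcarry (-g.b) g.b)⟩⟩

instance : Bracket (DescModel θ) (DescModel θ) := ⟨fun g h => ⟨0, 0,
  g.b * h.a - g.a * h.b,
  g.c₂ * h.a - g.a * h.c₂,
  g.c₃ * h.a - g.a * h.c₃,
  g.c₄ * h.a - g.a * h.c₄,
  g.c₅ * h.a - g.a * h.c₅ + (g.c₂ * h.b - g.b * h.c₂),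
  θ.f₁ * (g.c₆ * h.a - g.a * h.c₆) + θ.x * (g.c₂ * h.b - g.b * h.c₂)
    + θ.f₁ * (g.c₃ * h.b - g.b * h.c₃) + θ.y * (g.c₄ * h.b - g.b * h.c₄)
    + θ.f₂ * (g.c₆ * h.b - g.b * h.c₆) + θ.y * (g.c₂ * h.c₃ - g.c₃ * h.c₂)
    + θ.f₂ * (g.c₂ * h.c₅ - g.c₅ * h.c₂) - θ.f₂ * (g.c₃ * h.c₄ - g.c₄ * h.c₃)⟩⟩

theorem zero_def : (0 : DescModel θ) = ⟨0, 0, 0, 0, 0, 0, 0, 0⟩ := rfl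

theorem add_def (g h : DescModel θ) : g + h = ⟨g.a + h.a, g.b + h.b, g.c₂ + h.c₂, g.c₃ + h.c₃,
  g.c₄ + h.c₄, g.c₅ + h.c₅, g.c₆ + h.c₆,
  g.z + h.z + (θ.u * zcarry g.a h.a + θ.v * zcarry g.b h.b)⟩ := rfl

theorem neg_def (g : DescModel θ) : -g = ⟨-g.a, -g.b, -g.c₂, -g.c₃, -g.c₄, -g.c₅, -g.c₆,
  -g.z - (θ.u * zcarry (-g.a) g.a + θ.v * zcarry (-g.b) g.b)⟩ := rfl

theorem lie_def (g h : DescModel θ) : ⁅g, h⁆ = ⟨0, 0,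
  g.b * h.a - g.a * h.b,
  g.c₂ * h.a - g.a * h.c₂,
  g.c₃ * h.a - g.a * h.c₃,
  g.c₄ * h.a - g.a * h.c₄,
  g.c₅ * h.a - g.a * h.c₅ + (g.c₂ * h.b - g.b * h.c₂),
  θ.f₁ * (g.c₆ * h.a - g.a * h.c₆) + θ.x * (g.c₂ * h.b - g.b * h.c₂)
    + θ.f₁ * (g.c₃ * h.b - g.b * h.c₃) + θ.y * (g.c₄ * h.b - g.b * h.c₄)
    + θ.f₂ * (g.c₆ * h.b - g.b * h.c₆) + θ.y * (g.c₂ * h.c₃ - g.c₃ * h.c₂)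
    + θ.f₂ * (g.c₂ * h.c₅ - g.c₅ * h.c₂) - θ.f₂ * (g.c₃ * h.c₄ - g.c₄ * h.c₃)⟩ := rfl

instance : AddCommGroup (DescModel θ) :=
  { AddGroup.ofLeftAxioms (G := DescModel θ)
      (fun g h k => by
        have ha := zcarry_assoc g.a h.a k.a
        have hb := zcarry_assoc g.b h.b k.b
        simp only [add_def, mk.injEq, add_assoc, true_and]
        linear_combination θ.u * ha + θ.v * hb)
      (fun g => by simp [add_def, zero_def])
      (fun g => by
        simp only [add_def, zero_def, neg_def, neg_add_cancel, mk.injEq, true_and]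
        ring) with
    add_comm := fun g h => by
      simp only [add_def, mk.injEq]
      rw [zcarry_comm g.a, zcarry_comm g.b]
      simp only [add_comm, and_self] }

instance : LieRing (DescModel θ) where
  add_lie g h k := by
    simp only [add_def, lie_def, mk.injEq, zcarry_zero_left]
    refine ⟨?_, ?_, ?_, ?_, ?_, ?_, ?_, ?_⟩ <;> ring
  lie_add g h k := by
    simp only [add_def, lie_def, mk.injEq, zcarry_zero_left]
    refine ⟨?_, ?_, ?_, ?_, ?_, ?_, ?_, ?_⟩ <;> ring
  lie_self g := by
    simp only [zero_def, lie_def, mk.injEq, true_and]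
    refine ⟨?_, ?_, ?_, ?_, ?_, ?_⟩ <;> ring
  leibniz_lie g h k := by
    simp only [add_def, lie_def, mk.injEq, zcarry_zero_left]
    refine ⟨?_, ?_, ?_, ?_, ?_, ?_, ?_, ?_⟩ <;> ring

theorem nsmul_def (n : ℕ) (g : DescModel θ) : n • g =
    ⟨n * g.a, n * g.b, n * g.c₂, n * g.c₃, n * g.c₄, n * g.c₅, n * g.c₆,
      n * g.z + (θ.u * (n * g.a.val / p : ℕ) + θ.v * (n * g.b.val / p : ℕ))⟩ := by
  have key : ∀ (n : ℕ) (a : ZMod p),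
      ((n * a.val / p : ℕ) : ZMod p) + zcarry ((n : ZMod p) * a) a = ((n + 1) * a.val / p : ℕ) := by
    intro n a
    have hp : 0 < p := (Fact.out : p.Prime).pos
    rw [zcarry, ← Nat.cast_add]
    congr 1
    have h1 : ((n : ZMod p) * a).val = n * a.val % p := by
      rw [← ZMod.val_natCast, Nat.cast_mul, ZMod.natCast_zmod_val]
    have h2 : (n + 1) * a.val = (n * a.val % p + a.val) + p * (n * a.val / p) := by
      have := Nat.mod_add_div (n * a.val) p
      rw [add_mul, one_mul]; omega
    rw [h1, h2, Nat.add_mul_div_left _ _ hp, add_comm]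
  induction n with
  | zero => simp [zero_def]
  | succ n ih =>
    rw [succ_nsmul, ih, add_def]
    simp only [mk.injEq]
    rw [← key, ← key]
    push_cast
    refine ⟨?_, ?_, ?_, ?_, ?_, ?_, ?_, ?_⟩ <;> ring

theorem prime_nsmul (g : DescModel θ) :
    p • g = ⟨0, 0, 0, 0, 0, 0, 0, θ.u * g.a + θ.v * g.b⟩ := by
  have hp : 0 < p := (Fact.out : p.Prime).pos
  rw [nsmul_def]
  simp [Nat.mul_div_cancel_left _ hp]

instance : Finite (DescModel θ) := Finite.of_equiv _ (equivProd θ).symm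

/-- The generator `a`. -/
def A : DescModel θ := ⟨1, 0, 0, 0, 0, 0, 0, 0⟩
/-- The generator `b`. -/
def B : DescModel θ := ⟨0, 1, 0, 0, 0, 0, 0, 0⟩
/-- The generator of the last term. -/
def Z : DescModel θ := ⟨0, 0, 0, 0, 0, 0, 0, 1⟩

end DescModel

/-- The defining relations of the model Lie ring, for elements of an arbitrary Lie ring. -/
structure DescRel {p : ℕ} (θ : DescParam p) {X : Type*} [LieRing X]
    (A B C₂ C₃ C₄ C₅ C₆ Z : X) : Prop where
  lie_ba : ⁅B, A⁆ = C₂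
  lie_2a : ⁅C₂, A⁆ = C₃
  lie_3a : ⁅C₃, A⁆ = C₄
  lie_4a : ⁅C₄, A⁆ = C₅
  lie_5a : ⁅C₅, A⁆ = C₆
  lie_6a : ⁅C₆, A⁆ = θ.f₁.val • Z
  lie_6b : ⁅C₆, B⁆ = θ.f₂.val • Z
  lie_2b : ⁅C₂, B⁆ = C₆ + θ.x.val • Z
  lie_4b : ⁅C₄, B⁆ = θ.y.val • Z
  lie_za : ⁅Z, A⁆ = 0
  lie_zb : ⁅Z, B⁆ = 0
  nsmul_a : p • A = θ.u.val • Z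
  nsmul_b : p • B = θ.v.val • Z
  nsmul_z : p • Z = 0

section Torsion

variable {p : ℕ} {X : Type*} [AddCommGroup X]

/-- Multiples of a `p`-torsion element by residues modulo `p`. -/
def torsionHom (C : X) (hC : p • C = 0) : ZMod p →+ X :=
  ZMod.lift p ⟨zmultiplesHom X C, by simpa using hC⟩

theorem torsionHom_natCast (C : X) (hC : p • C = 0) (n : ℕ) :
    torsionHom C hC (n : ZMod p) = n • C := by
  have := ZMod.lift_coe p ⟨zmultiplesHom X C, by simpa using hC⟩ (n : ℤ)
  simpa [torsionHom] using this

theorem torsionHom_apply [NeZero p] (C : X) (hC : p • C = 0) (c : ZMod p) :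
    torsionHom C hC c = c.val • C := by
  rw [← torsionHom_natCast C hC, ZMod.natCast_zmod_val]

end Torsion

section Lie

variable {p : ℕ} {X : Type*} [LieRing X]

theorem lie_lie_right_s12 (P Q R : X) : ⁅P, ⁅Q, R⁆⁆ = ⁅⁅P, Q⁆, R⁆ - ⁅⁅P, R⁆, Q⁆ := by
  rw [leibniz_lie P Q R, ← lie_skew Q ⁅P, R⁆, sub_eq_add_neg]

theorem lie_lie_left (P Q R : X) : ⁅⁅P, Q⁆, R⁆ = ⁅⁅P, R⁆, Q⁆ + ⁅P, ⁅Q, R⁆⁆ := by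
  rw [lie_lie_right_s12]; abel

theorem nsmul_lie_eq_zero {P Q : X} (h : p • P = 0) : p • ⁅P, Q⁆ = 0 := by
  rw [← nsmul_lie, h, zero_lie]

theorem val_nsmul_lie_val_nsmul [NeZero p] {P Q : X} (F : ZMod p →+ X) (h : ⁅P, Q⁆ = F 1) :
    (∀ c d : ZMod p, ⁅c.val • P, d.val • Q⁆ = F (c * d)) ∧
      ∀ c d : ZMod p, ⁅c.val • Q, d.val • P⁆ = -F (c * d) := by
  have key : ∀ c d : ZMod p, ⁅c.val • P, d.val • Q⁆ = F (c * d) := by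
    intro c d
    have : c * d = (c.val * d.val) • (1 : ZMod p) := by simp
    rw [nsmul_lie, lie_nsmul, h, this, map_nsmul, mul_nsmul']
  refine ⟨key, fun c d => ?_⟩
  rw [← lie_skew, key, mul_comm]

end Lie

namespace DescRel

variable {p : ℕ} {θ : DescParam p} {X : Type*} [LieRing X]
  {A B C₂ C₃ C₄ C₅ C₆ Z : X}

theorem map {Y : Type*} [LieRing Y] (φ : X →ₗ⁅ℤ⁆ Y) (h : DescRel θ A B C₂ C₃ C₄ C₅ C₆ Z) :
    DescRel θ (φ A) (φ B) (φ C₂) (φ C₃) (φ C₄) (φ C₅) (φ C₆) (φ Z) := by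
  constructor <;> simp only [← LieHom.map_lie, ← map_nsmul, h.lie_ba, h.lie_2a, h.lie_3a,
    h.lie_4a, h.lie_5a, h.lie_6a, h.lie_6b, h.lie_2b, h.lie_4b, h.lie_za, h.lie_zb, h.nsmul_a,
    h.nsmul_b, h.nsmul_z, map_add, map_zero]

theorem exists_hom [Fact p.Prime] (h : DescRel θ A B C₂ C₃ C₄ C₅ C₆ Z) :
    ∃ φ : DescModel θ →ₗ⁅ℤ⁆ X, ∀ g, φ g = g.a.val • A + g.b.val • B + g.c₂.val • C₂
      + g.c₃.val • C₃ + g.c₄.val • C₄ + g.c₅.val • C₅ + g.c₆.val • C₆ + g.z.val • Z := by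
  obtain ⟨ba, c2a, c3a, c4a, c5a, c6a, c6b, c2b, c4b, cza, czb, pA, pB, pZ⟩ := h
  have p2 : p • C₂ = 0 := by rw [← ba, ← nsmul_lie, pB, nsmul_lie, cza, smul_zero]
  have p3 : p • C₃ = 0 := c2a ▸ nsmul_lie_eq_zero p2
  have p4 : p • C₄ = 0 := c3a ▸ nsmul_lie_eq_zero p3
  have p5 : p • C₅ = 0 := c4a ▸ nsmul_lie_eq_zero p4
  have p6 : p • C₆ = 0 := c5a ▸ nsmul_lie_eq_zero p5
  have ab : ⁅A, B⁆ = -C₂ := by rw [← lie_skew, ba]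
  have cz2 : ⁅Z, C₂⁆ = 0 := by rw [← ba, lie_lie_right_s12, cza, czb]; simp
  have cz3 : ⁅Z, C₃⁆ = 0 := by rw [← c2a, lie_lie_right_s12, cza, cz2]; simp
  have cz4 : ⁅Z, C₄⁆ = 0 := by rw [← c3a, lie_lie_right_s12, cza, cz3]; simp
  have cz5 : ⁅Z, C₅⁆ = 0 := by rw [← c4a, lie_lie_right_s12, cza, cz4]; simp
  have cz6 : ⁅Z, C₆⁆ = 0 := by rw [← c5a, lie_lie_right_s12, cza, cz5]; simp
  have c3b : ⁅C₃, B⁆ = θ.f₁.val • Z := by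
    rw [← c2a, lie_lie_left, c2b, ab, add_lie, c6a, nsmul_lie, cza]; simp
  have c23 : ⁅C₂, C₃⁆ = θ.y.val • Z := by
    rw [← c4b, ← c3a, lie_lie_left, c3b, ab, nsmul_lie, cza, lie_neg, lie_skew]; simp
  have c24 : ⁅C₂, C₄⁆ = 0 := by
    rw [← c3a, lie_lie_right_s12, c23, c2a, nsmul_lie, cza]; simp
  have c5b : ⁅C₅, B⁆ = 0 := by
    rw [← c4a, lie_lie_left, c4b, ab, nsmul_lie, cza, lie_neg, lie_skew, c24]; simp
  have c25 : ⁅C₂, C₅⁆ = θ.f₂.val • Z := by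
    rw [← c6b, ← c5a, lie_lie_left, c5b, ab, lie_neg, lie_skew]; simp
  have c34 : ⁅C₃, C₄⁆ = -(θ.f₂.val • Z) := by
    rw [← c2a, lie_lie_left, c24, ← lie_skew A C₄, c4a, lie_neg, c25]; simp
  have c35 : ⁅C₃, C₅⁆ = 0 := by
    rw [← c4a, lie_lie_right_s12, c34, c3a, neg_lie, nsmul_lie, cza]; simp
  have c26 : ⁅C₂, C₆⁆ = 0 := by
    rw [← c5a, lie_lie_right_s12, c25, c2a, c35, nsmul_lie, cza]; simp
  have c6' : C₆ = ⁅C₂, B⁆ - θ.x.val • Z := by rw [c2b]; abel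
  have c36 : ⁅C₃, C₆⁆ = 0 := by
    rw [c6', lie_sub, lie_lie_right_s12, c3b, ← lie_skew C₃ C₂, c23, lie_nsmul, ← lie_skew C₃ Z, cz3,
      nsmul_lie, cz2, neg_lie, nsmul_lie, czb]; simp
  have c45 : ⁅C₄, C₅⁆ = 0 := by
    have := lie_lie_right_s12 C₃ C₅ A
    rw [c5a, c36, c35, c3a, zero_lie, zero_sub] at this
    exact neg_eq_zero.mp this.symm
  have c46 : ⁅C₄, C₆⁆ = 0 := by
    rw [← c5a, lie_lie_right_s12, c45, c4a]; simp
  have c56 : ⁅C₅, C₆⁆ = 0 := by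
    rw [c6', lie_sub, lie_lie_right_s12, c5b, ← lie_skew C₅ C₂, c25, lie_nsmul, ← lie_skew C₅ Z, cz5,
      neg_lie, nsmul_lie, czb]; simp
  set T2 := torsionHom C₂ p2 with hT2
  set T3 := torsionHom C₃ p3 with hT3
  set T4 := torsionHom C₄ p4 with hT4
  set T5 := torsionHom C₅ p5 with hT5
  set T6 := torsionHom C₆ p6 with hT6
  set TZ := torsionHom Z pZ with hTZ
  have e2 : ∀ c : ZMod p, c.val • C₂ = T2 c := fun c => (torsionHom_apply C₂ p2 c).symm
  have e3 : ∀ c : ZMod p, c.val • C₃ = T3 c := fun c => (torsionHom_apply C₃ p3 c).symm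
  have e4 : ∀ c : ZMod p, c.val • C₄ = T4 c := fun c => (torsionHom_apply C₄ p4 c).symm
  have e5 : ∀ c : ZMod p, c.val • C₅ = T5 c := fun c => (torsionHom_apply C₅ p5 c).symm
  have e6 : ∀ c : ZMod p, c.val • C₆ = T6 c := fun c => (torsionHom_apply C₆ p6 c).symm
  have eZ : ∀ c : ZMod p, c.val • Z = TZ c := fun c => (torsionHom_apply Z pZ c).symm
  have one : (1 : ZMod p).val = 1 := ZMod.val_one p
  have o2 : T2 1 = C₂ := by rw [← e2, one, one_nsmul]
  have o3 : T3 1 = C₃ := by rw [← e3, one, one_nsmul]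
  have o4 : T4 1 = C₄ := by rw [← e4, one, one_nsmul]
  have o5 : T5 1 = C₅ := by rw [← e5, one, one_nsmul]
  have o6 : T6 1 = C₆ := by rw [← e6, one, one_nsmul]
  let S : ZMod p → ZMod p →+ X := fun t => TZ.comp (AddMonoidHom.mulLeft t)
  have hS : ∀ t c, S t c = TZ (t * c) := fun t c => rfl
  have s1 : ∀ t : ZMod p, t.val • Z = S t 1 := fun t => by rw [hS, mul_one, eZ]
  have hadd : ∀ (D : X) (w : ZMod p), p • D = w.val • Z → ∀ a b : ZMod p,
      (a + b).val • D + TZ (w * zcarry a b) = a.val • D + b.val • D := by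
    intro D w hD a b
    have : TZ (w * zcarry a b) = ((a.val + b.val) / p) • (p • D) := by
      rw [hD, eZ, ← map_nsmul, zcarry, nsmul_eq_mul, mul_comm]
    rw [this, smul_smul, mul_comm, ← add_nsmul, val_add_carry, add_nsmul]
  let Φ : DescModel θ → X := fun g => g.a.val • A + g.b.val • B + g.c₂.val • C₂
      + g.c₃.val • C₃ + g.c₄.val • C₄ + g.c₅.val • C₅ + g.c₆.val • C₆ + g.z.val • Z
  have Φadd : ∀ g h, Φ (g + h) = Φ g + Φ h := by
    intro g h
    have h1 := hadd A θ.u pA g.a h.a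
    have h2 := hadd B θ.v pB g.b h.b
    simp only [Φ, DescModel.add_def, e2, e3, e4, e5, e6, eZ, map_add]
    calc _ = ((g.a + h.a).val • A + TZ (θ.u * zcarry g.a h.a))
          + ((g.b + h.b).val • B + TZ (θ.v * zcarry g.b h.b)) + (T2 g.c₂ + T2 h.c₂)
          + (T3 g.c₃ + T3 h.c₃) + (T4 g.c₄ + T4 h.c₄) + (T5 g.c₅ + T5 h.c₅)
          + (T6 g.c₆ + T6 h.c₆) + (TZ g.z + TZ h.z) := by abel
      _ = _ := by rw [h1, h2]; abel
  have Φlie : ∀ g h, Φ ⁅g, h⁆ = ⁅Φ g, Φ h⁆ := by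
    intro g h
    have kAA := val_nsmul_lie_val_nsmul (0 : ZMod p →+ X) (lie_self A)
    have kBB := val_nsmul_lie_val_nsmul (0 : ZMod p →+ X) (lie_self B)
    have k22 := val_nsmul_lie_val_nsmul (0 : ZMod p →+ X) (lie_self C₂)
    have k33 := val_nsmul_lie_val_nsmul (0 : ZMod p →+ X) (lie_self C₃)
    have k44 := val_nsmul_lie_val_nsmul (0 : ZMod p →+ X) (lie_self C₄)
    have k55 := val_nsmul_lie_val_nsmul (0 : ZMod p →+ X) (lie_self C₅)
    have k66 := val_nsmul_lie_val_nsmul (0 : ZMod p →+ X) (lie_self C₆)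
    have kZZ := val_nsmul_lie_val_nsmul (0 : ZMod p →+ X) (lie_self Z)
    have kBA := val_nsmul_lie_val_nsmul T2 (ba.trans o2.symm)
    have k2A := val_nsmul_lie_val_nsmul T3 (c2a.trans o3.symm)
    have k3A := val_nsmul_lie_val_nsmul T4 (c3a.trans o4.symm)
    have k4A := val_nsmul_lie_val_nsmul T5 (c4a.trans o5.symm)
    have k5A := val_nsmul_lie_val_nsmul T6 (c5a.trans o6.symm)
    have k6A := val_nsmul_lie_val_nsmul (S θ.f₁) (c6a.trans (s1 _))
    have kZA := val_nsmul_lie_val_nsmul (0 : ZMod p →+ X) cza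
    have k2B := val_nsmul_lie_val_nsmul (T6 + S θ.x)
      (c2b.trans (by rw [AddMonoidHom.add_apply, o6, s1]))
    have k3B := val_nsmul_lie_val_nsmul (S θ.f₁) (c3b.trans (s1 _))
    have k4B := val_nsmul_lie_val_nsmul (S θ.y) (c4b.trans (s1 _))
    have k5B := val_nsmul_lie_val_nsmul (0 : ZMod p →+ X) c5b
    have k6B := val_nsmul_lie_val_nsmul (S θ.f₂) (c6b.trans (s1 _))
    have kZB := val_nsmul_lie_val_nsmul (0 : ZMod p →+ X) czb
    have k23 := val_nsmul_lie_val_nsmul (S θ.y) (c23.trans (s1 _))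
    have k24 := val_nsmul_lie_val_nsmul (0 : ZMod p →+ X) c24
    have k25 := val_nsmul_lie_val_nsmul (S θ.f₂) (c25.trans (s1 _))
    have k26 := val_nsmul_lie_val_nsmul (0 : ZMod p →+ X) c26
    have k34 := val_nsmul_lie_val_nsmul (-S θ.f₂)
      (c34.trans (by rw [AddMonoidHom.neg_apply, s1]))
    have k35 := val_nsmul_lie_val_nsmul (0 : ZMod p →+ X) c35
    have k36 := val_nsmul_lie_val_nsmul (0 : ZMod p →+ X) c36
    have k45 := val_nsmul_lie_val_nsmul (0 : ZMod p →+ X) c45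
    have k46 := val_nsmul_lie_val_nsmul (0 : ZMod p →+ X) c46
    have k56 := val_nsmul_lie_val_nsmul (0 : ZMod p →+ X) c56
    have kZ2 := val_nsmul_lie_val_nsmul (0 : ZMod p →+ X) cz2
    have kZ3 := val_nsmul_lie_val_nsmul (0 : ZMod p →+ X) cz3
    have kZ4 := val_nsmul_lie_val_nsmul (0 : ZMod p →+ X) cz4
    have kZ5 := val_nsmul_lie_val_nsmul (0 : ZMod p →+ X) cz5
    have kZ6 := val_nsmul_lie_val_nsmul (0 : ZMod p →+ X) cz6
    simp only [Φ, lie_add, add_lie, kAA, kBB, k22, k33, k44, k55, k66, kZZ, kBA, k2A, k3A, k4A,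
      k5A, k6A, kZA, k2B, k3B, k4B, k5B, k6B, kZB, k23, k24, k25, k26, k34, k35, k36, k45, k46,
      k56, kZ2, kZ3, kZ4, kZ5, kZ6, AddMonoidHom.zero_apply, AddMonoidHom.add_apply,
      AddMonoidHom.neg_apply, hS, neg_zero, add_zero, zero_add]
    simp only [DescModel.lie_def, e2, e3, e4, e5, e6, eZ, map_add, map_sub, mul_sub,
      ZMod.val_zero, zero_nsmul]
    abel
  refine ⟨{ toFun := Φ, map_add' := Φadd, map_smul' := ?_, map_lie' := Φlie _ _ }, fun g => rfl⟩
  intro m g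
  exact map_zsmul (AddMonoidHom.mk' Φ Φadd) m g

end DescRel

namespace DescModel

variable {p : ℕ} [Fact p.Prime] {θ : DescParam p}

theorem val_nsmul_Z (c : ZMod p) : c.val • (Z : DescModel θ) = ⟨0, 0, 0, 0, 0, 0, 0, c⟩ := by
  simp [nsmul_def, Z]

theorem descRel (θ : DescParam p) : DescRel θ (A : DescModel θ) B ⟨0, 0, 1, 0, 0, 0, 0, 0⟩
    ⟨0, 0, 0, 1, 0, 0, 0, 0⟩ ⟨0, 0, 0, 0, 1, 0, 0, 0⟩ ⟨0, 0, 0, 0, 0, 1, 0, 0⟩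
    ⟨0, 0, 0, 0, 0, 0, 1, 0⟩ Z := by
  constructor <;>
    simp [val_nsmul_Z, prime_nsmul, lie_def, A, B, zero_def, add_def] <;> simp [Z]

theorem eq_combination (g : DescModel θ) : g = g.a.val • A + g.b.val • B
    + g.c₂.val • ⟨0, 0, 1, 0, 0, 0, 0, 0⟩ + g.c₃.val • ⟨0, 0, 0, 1, 0, 0, 0, 0⟩
    + g.c₄.val • ⟨0, 0, 0, 0, 1, 0, 0, 0⟩ + g.c₅.val • ⟨0, 0, 0, 0, 0, 1, 0, 0⟩
    + g.c₆.val • ⟨0, 0, 0, 0, 0, 0, 1, 0⟩ + g.z.val • Z := by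
  have h : ∀ a : ZMod p, a.val / p = 0 := fun a => Nat.div_eq_of_lt (ZMod.val_lt a)
  have one : (1 : ZMod p).val = 1 := ZMod.val_one p
  simp [nsmul_def, A, B, Z, add_def, one, h]

/-- The terms of a filtration of the model containing the lower central series. -/
def InFiltration (k : ℕ) (g : DescModel θ) : Prop :=
  (1 ≤ k → g.a = 0 ∧ g.b = 0) ∧ (2 ≤ k → g.c₂ = 0) ∧ (3 ≤ k → g.c₃ = 0) ∧
    (4 ≤ k → g.c₄ = 0) ∧ (5 ≤ k → g.c₅ = 0) ∧ (6 ≤ k → g.c₆ = 0) ∧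
    (6 ≤ k → θ.f₁ = 0 → θ.f₂ = 0 → g.z = 0) ∧ (7 ≤ k → g.z = 0)

theorem InFiltration.lie {k : ℕ} {h : DescModel θ} (hh : InFiltration k h) (g : DescModel θ) :
    InFiltration (k + 1) ⁅g, h⁆ := by
  obtain ⟨h1, h2, h3, h4, h5, h6, h7, h8⟩ := hh
  simp only [InFiltration, lie_def]
  rcases k with _ | _ | _ | _ | _ | _ | _ | k <;> simp at h1 h2 h3 h4 h5 h6 h7 h8 <;>
    (simp [*]; try simp +contextual)

theorem InFiltration.mono {k l : ℕ} {h : DescModel θ} (hh : InFiltration k h) (hl : l ≤ k) :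
    InFiltration l h := by
  obtain ⟨h1, h2, h3, h4, h5, h6, h7, h8⟩ := hh
  exact ⟨fun _ => h1 (by omega), fun _ => h2 (by omega), fun _ => h3 (by omega),
    fun _ => h4 (by omega), fun _ => h5 (by omega), fun _ => h6 (by omega),
    fun _ => h7 (by omega), fun _ => h8 (by omega)⟩

/-- A filtration of the model containing the lower central series. -/
def filtration (θ : DescParam p) (k : ℕ) : LieIdeal ℤ (DescModel θ) where
  __ := AddSubgroup.toIntSubmodule
    { carrier := {g : DescModel θ | InFiltration k g}
      add_mem' := by
        rintro g h ⟨h1, h2, h3, h4, h5, h6, h7, h8⟩ ⟨i1, i2, i3, i4, i5, i6, i7, i8⟩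
        refine ⟨fun hk => ⟨?_, ?_⟩, fun hk => ?_, fun hk => ?_, fun hk => ?_, fun hk => ?_,
          fun hk => ?_, fun hk hf1 hf2 => ?_, fun hk => ?_⟩
        all_goals simp [add_def, h1 (by omega), i1 (by omega)]
        · simp [h2 hk, i2 hk]
        · simp [h3 hk, i3 hk]
        · simp [h4 hk, i4 hk]
        · simp [h5 hk, i5 hk]
        · simp [h6 hk, i6 hk]
        · simp [h7 hk hf1 hf2, i7 hk hf1 hf2]
        · simp [h8 hk, i8 hk]
      zero_mem' := by simp [InFiltration, zero_def]
      neg_mem' := by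
        rintro g ⟨h1, h2, h3, h4, h5, h6, h7, h8⟩
        refine ⟨fun hk => ⟨?_, ?_⟩, fun hk => ?_, fun hk => ?_, fun hk => ?_, fun hk => ?_,
          fun hk => ?_, fun hk hf1 hf2 => ?_, fun hk => ?_⟩
        all_goals simp [neg_def, h1 (by omega)]
        · simp [h2 hk]
        · simp [h3 hk]
        · simp [h4 hk]
        · simp [h5 hk]
        · simp [h6 hk]
        · simp [h7 hk hf1 hf2]
        · simp [h8 hk] }
  lie_mem {g _} hh := (InFiltration.lie hh g).mono (Nat.le_succ k)

theorem inFiltration_of_mem_lowerCentralSeries {k : ℕ} {g : DescModel θ}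
    (hg : g ∈ LieModule.lowerCentralSeries ℤ (DescModel θ) (DescModel θ) k) :
    InFiltration k g := by
  suffices h : LieModule.lowerCentralSeries ℤ (DescModel θ) (DescModel θ) k ≤ filtration θ k from
    h hg
  clear hg
  induction k with
  | zero => intro g _; change InFiltration 0 g; simp [InFiltration]
  | succ k ih =>
    rw [LieModule.lowerCentralSeries_succ, LieSubmodule.lie_le_iff]
    intro g _ h hh
    exact InFiltration.lie (ih hh) g

end DescModel

section LowerCentralSeries

variable {X : Type*} [LieRing X]

theorem lie_mem_lcs_succ {k : ℕ} {g : X} (hg : g ∈ LieModule.lowerCentralSeries ℤ X X k) (h : X) :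
    ⁅g, h⁆ ∈ LieModule.lowerCentralSeries ℤ X X (k + 1) := by
  rw [← lie_skew, LieModule.lowerCentralSeries_succ]
  exact neg_mem (LieSubmodule.lie_mem_lie (LieSubmodule.mem_top h) hg)

theorem map_mem_lcs {Y : Type*} [LieRing Y] (φ : X →ₗ⁅ℤ⁆ Y) {k : ℕ} {g : X}
    (hg : g ∈ LieModule.lowerCentralSeries ℤ X X k) :
    φ g ∈ LieModule.lowerCentralSeries ℤ Y Y k :=
  LieIdeal.map_lowerCentralSeries_le k (f := φ) (LieIdeal.mem_map hg)

theorem DescRel.mem_lcs {p : ℕ} {θ : DescParam p} {A B C₂ C₃ C₄ C₅ C₆ Z : X}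
    (h : DescRel θ A B C₂ C₃ C₄ C₅ C₆ Z) : C₆ ∈ LieModule.lowerCentralSeries ℤ X X 5 := by
  obtain ⟨ba, c2a, c3a, c4a, c5a, -⟩ := h
  rw [← c5a, ← c4a, ← c3a, ← c2a, ← ba]
  iterate 5 apply lie_mem_lcs_succ
  simp

end LowerCentralSeries

namespace DescModel

variable {p : ℕ} [Fact p.Prime] {θ : DescParam p}

theorem mem_lcs_six (hθ : θ.f₁ ≠ 0 ∨ θ.f₂ ≠ 0) (g : DescModel θ) :
    g ∈ LieModule.lowerCentralSeries ℤ (DescModel θ) (DescModel θ) 6 ↔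
      g = ⟨0, 0, 0, 0, 0, 0, 0, g.z⟩ := by
  constructor
  · intro hg
    obtain ⟨h1, h2, h3, h4, h5, h6, -⟩ := inFiltration_of_mem_lowerCentralSeries hg
    ext <;> simp [h1, h2, h3, h4, h5, h6]
  · intro hg
    have h6 := (descRel θ).mem_lcs
    have key : ∀ f c : ZMod p, f ≠ 0 → f.val • (Z : DescModel θ) ∈
        LieModule.lowerCentralSeries ℤ (DescModel θ) (DescModel θ) 6 →
        (⟨0, 0, 0, 0, 0, 0, 0, c⟩ : DescModel θ) ∈
          LieModule.lowerCentralSeries ℤ (DescModel θ) (DescModel θ) 6 := by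
      intro f c hf h
      have := nsmul_mem h (c / f).val
      rw [val_nsmul_Z, nsmul_def] at this
      simpa [div_mul_cancel₀ c hf] using this
    rw [hg]
    rcases hθ with hf | hf
    · exact key _ _ hf ((descRel θ).lie_6a ▸ lie_mem_lcs_succ h6 _)
    · exact key _ _ hf ((descRel θ).lie_6b ▸ lie_mem_lcs_succ h6 _)

theorem lcs_six_eq_bot (h1 : θ.f₁ = 0) (h2 : θ.f₂ = 0) :
    LieModule.lowerCentralSeries ℤ (DescModel θ) (DescModel θ) 6 = ⊥ := by
  rw [eq_bot_iff]
  intro g hg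
  obtain ⟨i1, i2, i3, i4, i5, i6, i7, -⟩ := inFiltration_of_mem_lowerCentralSeries hg
  rw [LieSubmodule.mem_bot]
  ext <;> simp [zero_def, i1, i2, i3, i4, i5, i6, i7, h1, h2]

theorem lcs_seven_eq_bot (θ : DescParam p) :
    LieModule.lowerCentralSeries ℤ (DescModel θ) (DescModel θ) 7 = ⊥ := by
  rw [eq_bot_iff]
  intro g hg
  obtain ⟨i1, i2, i3, i4, i5, i6, i7, i8⟩ := inFiltration_of_mem_lowerCentralSeries hg
  rw [LieSubmodule.mem_bot]
  ext <;> simp [zero_def, i1, i2, i3, i4, i5, i6, i8]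

theorem Z_ne_zero : (Z : DescModel θ) ≠ 0 := by
  intro h
  have := congrArg DescModel.z h
  simp [Z, zero_def] at this

theorem natCard_lcs_six (hθ : θ.f₁ ≠ 0 ∨ θ.f₂ ≠ 0) :
    Nat.card (LieModule.lowerCentralSeries ℤ (DescModel θ) (DescModel θ) 6) = p := by
  exact (Nat.card_congr (β := ZMod p)
    { toFun := fun g => g.1.z
      invFun := fun c => ⟨⟨0, 0, 0, 0, 0, 0, 0, c⟩, (mem_lcs_six hθ _).2 rfl⟩
      left_inv := fun g => Subtype.ext ((mem_lcs_six hθ g.1).1 g.2).symm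
      right_inv := fun _ => rfl }).trans (Nat.card_zmod p)

theorem lcs_six_ne_bot (hθ : θ.f₁ ≠ 0 ∨ θ.f₂ ≠ 0) :
    LieModule.lowerCentralSeries ℤ (DescModel θ) (DescModel θ) 6 ≠ ⊥ := by
  intro h
  have : (Z : DescModel θ) ∈ LieModule.lowerCentralSeries ℤ (DescModel θ) (DescModel θ) 6 :=
    (mem_lcs_six hθ _).2 rfl
  rw [h, LieSubmodule.mem_bot] at this
  exact Z_ne_zero this

end DescModel

section Quotient

variable {X : Type*} [LieRing X]

/-- The quotient map of a Lie ring by an ideal. -/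
def quotLieHom (I : LieIdeal ℤ X) : X →ₗ⁅ℤ⁆ X ⧸ I where
  __ := I.toSubmodule.mkQ
  map_lie' {g h} := LieSubmodule.Quotient.mk_bracket I g h

theorem quotLieHom_surjective (I : LieIdeal ℤ X) : Function.Surjective (quotLieHom I) :=
  Submodule.mkQ_surjective I.toSubmodule

theorem quotLieHom_eq_zero {I : LieIdeal ℤ X} {g : X} : quotLieHom I g = 0 ↔ g ∈ I :=
  Submodule.Quotient.mk_eq_zero I.toSubmodule

theorem isLieIso_quotient {Y : Type*} [LieRing Y] (I : LieIdeal ℤ X) (φ : X →ₗ⁅ℤ⁆ Y)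
    (hφ : Function.Surjective φ) (hI : ∀ g, φ g = 0 ↔ g ∈ I) : IsLieIso (X ⧸ I) Y := by
  let f : X ⧸ I →+ Y := QuotientAddGroup.lift I.toSubmodule.toAddSubgroup
    (φ : X →ₗ[ℤ] Y).toAddMonoidHom fun g hg => (hI g).2 hg
  have hf : ∀ g, f (quotLieHom I g) = φ g := fun g => rfl
  refine ⟨Equiv.ofBijective f ⟨?_, ?_⟩, map_add f, ?_⟩
  · rw [injective_iff_map_eq_zero]
    intro g hg
    obtain ⟨g, rfl⟩ := quotLieHom_surjective I g
    exact quotLieHom_eq_zero.2 ((hI g).1 hg)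
  · intro y
    obtain ⟨g, rfl⟩ := hφ y
    exact ⟨_, hf g⟩
  · intro g h
    obtain ⟨g, rfl⟩ := quotLieHom_surjective I g
    obtain ⟨h, rfl⟩ := quotLieHom_surjective I h
    have key : f ⁅quotLieHom I g, quotLieHom I h⁆ = ⁅f (quotLieHom I g), f (quotLieHom I h)⁆ := by
      rw [← LieHom.map_lie, hf, hf, hf, LieHom.map_lie]
    exact key

end Quotient

section Iso

variable {X Y W : Type*} [LieRing X] [LieRing Y] [LieRing W]

theorem IsLieIso.exists_lieEquiv (h : IsLieIso X Y) : Nonempty (X ≃ₗ⁅ℤ⁆ Y) := by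
  obtain ⟨e, he, hl⟩ := h
  exact ⟨{ (AddEquiv.mk' e he).toIntLinearEquiv with map_lie' := hl _ _ }⟩

theorem LieEquiv.isLieIso (e : X ≃ₗ⁅ℤ⁆ Y) : IsLieIso X Y :=
  ⟨e.toLinearEquiv.toEquiv, map_add e.toLinearEquiv, LieEquiv.map_lie e⟩

theorem isLieIso_of_bijective (φ : X →ₗ⁅ℤ⁆ Y) (h : Function.Bijective φ) : IsLieIso X Y :=
  (LieEquiv.ofBijective φ h).isLieIso

theorem IsLieIso.refl (X : Type*) [LieRing X] : IsLieIso X X :=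
  ⟨Equiv.refl X, fun _ _ => rfl, fun _ _ => rfl⟩

theorem IsLieIso.symm (h : IsLieIso X Y) : IsLieIso Y X := by
  obtain ⟨e⟩ := h.exists_lieEquiv
  exact e.symm.isLieIso

theorem IsLieIso.trans (h : IsLieIso X Y) (h' : IsLieIso Y W) : IsLieIso X W := by
  obtain ⟨e⟩ := h.exists_lieEquiv
  obtain ⟨e'⟩ := h'.exists_lieEquiv
  exact (e.trans e').isLieIso

end Iso

/-- The Lie ring of order `p^7` whose descendants are counted. -/
abbrev BaseRing (p : ℕ) : Type := presLie p {bab - ba5, ba3b}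

/-- The ideal of relations of `BaseRing`. -/
noncomputable abbrev baseIdeal (p : ℕ) : LieIdeal ℤ FL :=
  LieSubmodule.lieSpan ℤ FL ({bab - ba5, ba3b} ∪ {p • ga, p • gb}) ⊔
    LieModule.lowerCentralSeries ℤ FL FL 6

namespace BaseRing

variable {p : ℕ}

theorem mk_eq_zero_of_mem {g : FL}
    (hg : g ∈ ({bab - ba5, ba3b} ∪ {p • ga, p • gb} : Set FL)) :
    quotLieHom (baseIdeal p) g = 0 :=
  quotLieHom_eq_zero.2 (le_sup_left (a := LieSubmodule.lieSpan ℤ FL _)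
    (LieSubmodule.subset_lieSpan hg))

theorem mk_eq_zero_of_mem_lcs {g : FL} (hg : g ∈ LieModule.lowerCentralSeries ℤ FL FL 6) :
    quotLieHom (baseIdeal p) g = 0 :=
  quotLieHom_eq_zero.2 (le_sup_right (b := LieModule.lowerCentralSeries ℤ FL FL 6) hg)

theorem descRel (θ : DescParam p) :
    DescRel θ (quotLieHom (baseIdeal p) ga) (quotLieHom (baseIdeal p) gb)
      (quotLieHom (baseIdeal p) ⁅gb, ga⁆) (quotLieHom (baseIdeal p) ⁅⁅gb, ga⁆, ga⁆)
      (quotLieHom (baseIdeal p) ba3) (quotLieHom (baseIdeal p) ba4)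
      (quotLieHom (baseIdeal p) ba5) 0 := by
  have h5 : ba5 ∈ LieModule.lowerCentralSeries ℤ FL FL 5 := by
    rw [ba5, ba4, ba3]
    iterate 5 apply lie_mem_lcs_succ
    simp
  constructor
  case lie_6a => rw [← LieHom.map_lie, mk_eq_zero_of_mem_lcs (lie_mem_lcs_succ h5 _), smul_zero]
  case lie_6b => rw [← LieHom.map_lie, mk_eq_zero_of_mem_lcs (lie_mem_lcs_succ h5 _), smul_zero]
  case lie_2b =>
    rw [← LieHom.map_lie, smul_zero, add_zero, ← sub_eq_zero, ← map_sub]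
    exact mk_eq_zero_of_mem (by simp [bab])
  case lie_4b =>
    rw [← LieHom.map_lie, smul_zero]
    exact mk_eq_zero_of_mem (by simp [ba3b])
  case nsmul_a =>
    rw [← map_nsmul, smul_zero]
    exact mk_eq_zero_of_mem (by simp)
  case nsmul_b =>
    rw [← map_nsmul, smul_zero]
    exact mk_eq_zero_of_mem (by simp)
  all_goals simp only [← LieHom.map_lie, ba5, ba4, ba3, zero_lie, smul_zero]

theorem lcs_six_eq_bot : LieModule.lowerCentralSeries ℤ (BaseRing p) (BaseRing p) 6 = ⊥ := by
  rw [← LieIdeal.lowerCentralSeries_map_eq 6 (quotLieHom_surjective (baseIdeal p)),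
    LieIdeal.map_eq_bot_iff]
  intro g hg
  exact LieHom.mem_ker.2 (mk_eq_zero_of_mem_lcs hg)

/-- The base ring is the quotient of the model by the seventh term of its lower central series. -/
theorem exists_hom [Fact p.Prime] {θ : DescParam p} (hθ : θ.f₁ ≠ 0 ∨ θ.f₂ ≠ 0) :
    ∃ φ : DescModel θ →ₗ⁅ℤ⁆ BaseRing p, Function.Surjective φ ∧
      ∀ g, φ g = 0 ↔ g ∈ LieModule.lowerCentralSeries ℤ (DescModel θ) (DescModel θ) 6 := by
  obtain ⟨φ, hφ⟩ := (descRel θ).exists_hom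
  have one : (1 : ZMod p).val = 1 := ZMod.val_one p
  let ψ : FL →ₗ⁅ℤ⁆ DescModel θ := FreeLieAlgebra.lift ℤ ![DescModel.A, DescModel.B]
  have ψa : ψ ga = DescModel.A := FreeLieAlgebra.lift_of_apply _ _
  have ψb : ψ gb = DescModel.B := FreeLieAlgebra.lift_of_apply _ _
  have hcomp : ∀ w, φ (ψ w) = quotLieHom (baseIdeal p) w := by
    suffices h : φ.comp ψ = quotLieHom (baseIdeal p) from fun w => LieHom.congr_fun h w
    apply FreeLieAlgebra.hom_ext
    intro i
    fin_cases i
    · change φ (ψ ga) = quotLieHom (baseIdeal p) ga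
      rw [ψa, hφ]; simp only [DescModel.A, one, ZMod.val_zero, zero_smul, one_smul, add_zero, smul_zero]
    · change φ (ψ gb) = quotLieHom (baseIdeal p) gb
      rw [ψb, hφ]; simp only [DescModel.B, one, ZMod.val_zero, zero_smul, one_smul, add_zero, zero_add,
        smul_zero]
  have hlcs : ∀ g ∈ LieModule.lowerCentralSeries ℤ (DescModel θ) (DescModel θ) 6, φ g = 0 := by
    intro g hg
    have := map_mem_lcs φ hg
    rwa [lcs_six_eq_bot, LieSubmodule.mem_bot] at this
  refine ⟨φ, fun m => ?_, fun g => ⟨fun hg => ?_, hlcs g⟩⟩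
  · obtain ⟨w, rfl⟩ := quotLieHom_surjective _ m
    exact ⟨ψ w, hcomp w⟩
  set I := LieModule.lowerCentralSeries ℤ (DescModel θ) (DescModel θ) 6 with hI
  have hψ : ∀ w, quotLieHom (baseIdeal p) w = 0 → ψ w ∈ I := by
    intro w hw
    rw [quotLieHom_eq_zero] at hw
    suffices h : baseIdeal p ≤ LieIdeal.comap ψ I from LieIdeal.mem_comap.1 (h hw)
    refine sup_le ?_ fun w hw => LieIdeal.mem_comap.2 (map_mem_lcs ψ hw)
    rw [LieSubmodule.lieSpan_le]
    rintro w ((rfl | rfl) | (rfl | rfl)) <;> rw [SetLike.mem_coe, LieIdeal.mem_comap, hI,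
      DescModel.mem_lcs_six hθ]
    · rw [bab, ba5, ba4, ba3, map_sub]
      simp only [LieHom.map_lie, ψa, ψb]
      simp [DescModel.A, DescModel.B, DescModel.lie_def, sub_eq_add_neg, DescModel.add_def,
        DescModel.neg_def]
    · rw [ba3b, ba3]
      simp only [LieHom.map_lie, ψa, ψb]
      simp [DescModel.A, DescModel.B, DescModel.lie_def]
    · simp [ψa, DescModel.prime_nsmul]
    · simp [ψb, DescModel.prime_nsmul]
  have hZ : (DescModel.Z : DescModel θ) ∈ I := (DescModel.mem_lcs_six hθ _).2 rfl
  obtain ⟨w, hw⟩ : ∃ w, g - ψ w ∈ I := by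
    let w : FL := g.a.val • ga + g.b.val • gb + g.c₂.val • ⁅gb, ga⁆ + g.c₃.val • ⁅⁅gb, ga⁆, ga⁆
      + g.c₄.val • ba3 + g.c₅.val • ba4 + g.c₆.val • ba5
    refine ⟨w, ?_⟩
    have hr := DescModel.descRel θ
    have hw : g - ψ w = g.z.val • DescModel.Z := by
      rw [sub_eq_iff_eq_add', g.eq_combination]
      congr 1
      simp only [w, map_add, map_nsmul, LieHom.map_lie, ψa, ψb, ba5, ba4, ba3, hr.lie_ba,
        hr.lie_2a, hr.lie_3a, hr.lie_4a, hr.lie_5a]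
      rw [← g.eq_combination]
    rw [hw]
    exact nsmul_mem hZ _
  have h0 := hlcs _ hw
  rw [map_sub, hg, zero_sub, neg_eq_zero, hcomp] at h0
  have := add_mem hw (hψ w h0)
  rwa [sub_add_cancel] at this

end BaseRing

theorem DescRel.exists_hom_generators {p : ℕ} [Fact p.Prime] {θ : DescParam p} {X : Type*}
    [LieRing X] {A B C₂ C₃ C₄ C₅ C₆ Z : X} (h : DescRel θ A B C₂ C₃ C₄ C₅ C₆ Z) :
    ∃ φ : DescModel θ →ₗ⁅ℤ⁆ X, φ DescModel.A = A ∧ φ DescModel.B = B ∧ φ DescModel.Z = Z := by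
  obtain ⟨φ, hφ⟩ := h.exists_hom
  have one : (1 : ZMod p).val = 1 := ZMod.val_one p
  refine ⟨φ, ?_, ?_, ?_⟩ <;> rw [hφ] <;>
    simp only [DescModel.A, DescModel.B, DescModel.Z, one, ZMod.val_zero, zero_smul, one_smul,
      add_zero, zero_add]

/-- Nilpotent of class 7, with class 6 quotient `BaseRing p`. -/
def IsDescendant (p : ℕ) (X : Type*) [LieRing X] : Prop :=
  LieClassEq X 7 ∧ IsLieIso (X ⧸ LieModule.lowerCentralSeries ℤ X X 6) (BaseRing p)

namespace IsDescendant

variable {p : ℕ} [Fact p.Prime] {X : Type*} [LieRing X]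

theorem of_isLieIso {θ : DescParam p} (hθ : θ.f₁ ≠ 0 ∨ θ.f₂ ≠ 0) (h : IsLieIso (DescModel θ) X) :
    IsDescendant p X := by
  obtain ⟨e⟩ := h.exists_lieEquiv
  obtain ⟨φ, hφ, hk⟩ := BaseRing.exists_hom hθ
  have hlcs : ∀ k g, e.symm g ∈ LieModule.lowerCentralSeries ℤ (DescModel θ) (DescModel θ) k ↔
      g ∈ LieModule.lowerCentralSeries ℤ X X k := fun k g =>
    ⟨fun hg => by simpa using map_mem_lcs e.toLieHom hg, fun hg => map_mem_lcs e.symm.toLieHom hg⟩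
  refine ⟨⟨?_, fun h6 => ?_⟩, ?_⟩
  · rw [eq_bot_iff]
    intro g hg
    rw [← hlcs, DescModel.lcs_seven_eq_bot, LieSubmodule.mem_bot] at hg
    rw [LieSubmodule.mem_bot, ← e.apply_symm_apply g, hg]
    exact map_zero e.toLieHom
  · refine DescModel.lcs_six_ne_bot hθ (eq_bot_iff.2 fun g hg => ?_)
    rw [← e.symm_apply_apply g, hlcs, h6, LieSubmodule.mem_bot] at hg
    rw [LieSubmodule.mem_bot, ← e.symm_apply_apply g, hg]
    exact map_zero e.symm.toLieHom
  · refine isLieIso_quotient _ (φ.comp e.symm.toLieHom) (hφ.comp e.symm.surjective) fun g => ?_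
    rw [← hlcs, ← hk]
    rfl

theorem natCard_baseRing : Nat.card (BaseRing p) = p ^ 7 := by
  let θ : DescParam p := ⟨1, 0, 0, 0, 0, 0⟩
  have hθ : θ.f₁ ≠ 0 ∨ θ.f₂ ≠ 0 := Or.inl one_ne_zero
  obtain ⟨φ, hφ, hk⟩ := BaseRing.exists_hom hθ
  obtain ⟨e, -⟩ := isLieIso_quotient _ φ hφ hk
  have h := Submodule.card_eq_card_quotient_mul_card
    (LieModule.lowerCentralSeries ℤ (DescModel θ) (DescModel θ) 6).toSubmodule
  have h1 : Nat.card (LieModule.lowerCentralSeries ℤ (DescModel θ) (DescModel θ) 6).toSubmodule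
      = p := DescModel.natCard_lcs_six hθ
  have h2 : Nat.card (DescModel θ ⧸
      (LieModule.lowerCentralSeries ℤ (DescModel θ) (DescModel θ) 6).toSubmodule)
      = Nat.card (BaseRing p) := Nat.card_congr e
  rw [h1, h2, DescModel.natCard, pow_succ'] at h
  exact (Nat.eq_of_mul_eq_mul_left (Fact.out : p.Prime).pos h).symm

theorem natCard_lcs_six (hX : Nat.card X = p ^ 8) (h : IsDescendant p X) :
    Nat.card (LieModule.lowerCentralSeries ℤ X X 6) = p := by
  obtain ⟨e, -⟩ := h.2
  have h := Submodule.card_eq_card_quotient_mul_card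
    (LieModule.lowerCentralSeries ℤ X X 6).toSubmodule
  have h2 : Nat.card (X ⧸ (LieModule.lowerCentralSeries ℤ X X 6).toSubmodule) = p ^ 7 :=
    (Nat.card_congr e).trans natCard_baseRing
  rw [h2, hX, pow_succ'] at h
  exact (Nat.eq_of_mul_eq_mul_right (pow_pos (Fact.out : p.Prime).pos 7) h).symm

theorem exists_generator_lcs_six (hX : Nat.card X = p ^ 8) (h : IsDescendant p X) :
    ∃ Z ∈ LieModule.lowerCentralSeries ℤ X X 6, p • Z = 0 ∧
      ∀ g ∈ LieModule.lowerCentralSeries ℤ X X 6, ∃ c : ZMod p, g = c.val • Z := by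
  set I := LieModule.lowerCentralSeries ℤ X X 6
  have hc : Nat.card I = p := natCard_lcs_six hX h
  have : Nontrivial I := by
    have : Finite I := Nat.finite_of_card_ne_zero (by rw [hc]; exact (Fact.out : p.Prime).ne_zero)
    rw [← Finite.one_lt_card_iff_nontrivial, hc]
    exact (Fact.out : p.Prime).one_lt
  obtain ⟨Z, hZ⟩ := exists_ne (0 : I)
  have hpZ : p • Z = 0 := by rw [← hc]; exact card_nsmul_eq_zero'
  refine ⟨Z, Z.2, congrArg Subtype.val hpZ, fun g hg => ?_⟩
  obtain ⟨n, hn⟩ := mem_multiples_of_prime_card hc hZ (g' := ⟨g, hg⟩)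
  have hn : n • (Z : X) = g := congrArg Subtype.val hn
  have hpZ : p • (Z : X) = 0 := congrArg Subtype.val hpZ
  refine ⟨n, ?_⟩
  rw [← torsionHom_apply (Z : X) hpZ, torsionHom_natCast, hn]

theorem exists_isLieIso_model (hX : Nat.card X = p ^ 8) (h : IsDescendant p X) :
    ∃ θ : DescParam p, (θ.f₁ ≠ 0 ∨ θ.f₂ ≠ 0) ∧ IsLieIso (DescModel θ) X := by
  obtain ⟨Z, hZ, hpZ, hgen⟩ := exists_generator_lcs_six hX h
  obtain ⟨⟨h7, h6⟩, hiso⟩ := h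
  obtain ⟨e⟩ := hiso.exists_lieEquiv
  let π : X →ₗ⁅ℤ⁆ BaseRing p := e.toLieHom.comp (quotLieHom _)
  have hπ : Function.Surjective π := e.surjective.comp (quotLieHom_surjective _)
  have hker : ∀ g, π g = 0 → ∃ c : ZMod p, g = c.val • Z := by
    intro g hg
    refine hgen g (quotLieHom_eq_zero.1 (e.injective (hg.trans ?_)))
    exact (map_zero e.toLieHom).symm
  obtain ⟨A, hA⟩ := hπ (quotLieHom (baseIdeal p) ga)
  obtain ⟨B, hB⟩ := hπ (quotLieHom (baseIdeal p) gb)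
  have hr := BaseRing.descRel (p := p) ⟨0, 0, 0, 0, 0, 0⟩
  simp only [← hA, ← hB, ba5, ba4, ba3, LieHom.map_lie] at hr
  simp only [← LieHom.map_lie] at hr
  have hlie : ∀ g : X, ⁅Z, g⁆ = 0 := by
    intro g
    have := lie_mem_lcs_succ hZ g
    rwa [h7, LieSubmodule.mem_bot] at this
  obtain ⟨f₁, hf₁⟩ := hker ⁅⁅⁅⁅⁅⁅B, A⁆, A⁆, A⁆, A⁆, A⁆, A⁆
    (by rw [LieHom.map_lie, hr.lie_6a, smul_zero])
  obtain ⟨f₂, hf₂⟩ := hker ⁅⁅⁅⁅⁅⁅B, A⁆, A⁆, A⁆, A⁆, A⁆, B⁆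
    (by rw [LieHom.map_lie, hr.lie_6b, smul_zero])
  obtain ⟨x, hx⟩ := hker (⁅⁅B, A⁆, B⁆ - ⁅⁅⁅⁅⁅B, A⁆, A⁆, A⁆, A⁆, A⁆)
    (by rw [map_sub, LieHom.map_lie, hr.lie_2b, smul_zero, add_zero, sub_self])
  obtain ⟨y, hy⟩ := hker ⁅⁅⁅⁅B, A⁆, A⁆, A⁆, B⁆
    (by rw [LieHom.map_lie, hr.lie_4b, smul_zero])
  obtain ⟨u, hu⟩ := hker (p • A) (by rw [map_nsmul, hr.nsmul_a, smul_zero])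
  obtain ⟨v, hv⟩ := hker (p • B) (by rw [map_nsmul, hr.nsmul_b, smul_zero])
  have hX' : DescRel ⟨f₁, f₂, x, y, u, v⟩ A B ⁅B, A⁆ ⁅⁅B, A⁆, A⁆ ⁅⁅⁅B, A⁆, A⁆, A⁆
      ⁅⁅⁅⁅B, A⁆, A⁆, A⁆, A⁆ ⁅⁅⁅⁅⁅B, A⁆, A⁆, A⁆, A⁆, A⁆ Z :=
    ⟨rfl, rfl, rfl, rfl, rfl, hf₁, hf₂, sub_eq_iff_eq_add'.1 hx, hy, hlie A, hlie B, hu, hv, hpZ⟩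
  generalize (⟨f₁, f₂, x, y, u, v⟩ : DescParam p) = θ at hX'
  obtain ⟨φ, φA, φB, φZ⟩ := hX'.exists_hom_generators
  let ψ : FL →ₗ⁅ℤ⁆ DescModel θ := FreeLieAlgebra.lift ℤ ![DescModel.A, DescModel.B]
  have ψa : ψ ga = DescModel.A := FreeLieAlgebra.lift_of_apply _ _
  have ψb : ψ gb = DescModel.B := FreeLieAlgebra.lift_of_apply _ _
  have hcomp : ∀ w, π (φ (ψ w)) = quotLieHom (baseIdeal p) w := by
    suffices h : π.comp (φ.comp ψ) = quotLieHom (baseIdeal p) from fun w => LieHom.congr_fun h w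
    apply FreeLieAlgebra.hom_ext
    intro i
    fin_cases i
    · change π (φ (ψ ga)) = quotLieHom (baseIdeal p) ga
      rw [ψa, φA, hA]
    · change π (φ (ψ gb)) = quotLieHom (baseIdeal p) gb
      rw [ψb, φB, hB]
  have hφ : Function.Surjective φ := by
    intro g
    obtain ⟨w, hw⟩ := quotLieHom_surjective (baseIdeal p) (π g)
    obtain ⟨c, hc⟩ := hker (g - φ (ψ w)) (by rw [map_sub, hcomp, hw, sub_self])
    refine ⟨c.val • DescModel.Z + ψ w, ?_⟩
    rw [map_add, map_nsmul, φZ, ← hc, sub_add_cancel]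
  refine ⟨θ, ?_, isLieIso_of_bijective φ
    (hφ.bijective_of_nat_card_le (by rw [hX, DescModel.natCard]))⟩
  by_contra! hθ
  refine h6 ?_
  rw [← LieIdeal.lowerCentralSeries_map_eq 6 hφ, LieIdeal.map_eq_bot_iff,
    DescModel.lcs_six_eq_bot hθ.1 hθ.2]
  exact bot_le

end IsDescendant

section Transport

variable {X α : Type*} [LieRing X]

/-- The Lie ring structure transported along a bijection. -/
abbrev transportLieRing (e : α ≃ X) : LieRing α :=
  letI := e.addCommGroup
  { bracket := fun g h => e.symm ⁅e g, e h⁆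
    add_lie := fun g h k => e.injective (by simp [Equiv.add_def])
    lie_add := fun g h k => e.injective (by simp [Equiv.add_def])
    lie_self := fun g => e.injective (by simp [Equiv.zero_def])
    leibniz_lie := fun g h k => e.injective (by simp [Equiv.add_def]) }

theorem isLieIso_transport (e : α ≃ X) : @IsLieIso X α _ (transportLieRing e) := by
  let := transportLieRing e
  refine IsLieIso.symm ⟨e, fun g h => ?_, fun g h => ?_⟩
  · exact e.apply_symm_apply _
  · exact e.apply_symm_apply _

end Transport

namespace DescModel

variable {p : ℕ} [Fact p.Prime] {θ θ' : DescParam p}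

theorem isLieIso_of_param {α β s₃ s₅ l : ZMod p} (hα : α ≠ 0) (hl : l ≠ 0)
    (hf₁ : l * θ'.f₁ = α ^ 9 * (α * θ.f₁ + β * θ.f₂)) (hf₂ : l * θ'.f₂ = α ^ 13 * θ.f₂)
    (hx : l * θ'.x = α ^ 9 * θ.x + 2 * α ^ 5 * s₃ * θ.y
      + θ.f₂ * (2 * α ^ 5 * s₅ + α * s₃ ^ 2))
    (hy : l * θ'.y = α ^ 11 * θ.y + 2 * α ^ 7 * s₃ * θ.f₂)
    (hu : l * θ'.u = α * θ.u + β * θ.v) (hv : l * θ'.v = α ^ 4 * θ.v) :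
    IsLieIso (DescModel θ') (DescModel θ) := by
  let A' : DescModel θ := ⟨α, β, 0, 0, 0, 0, 0, 0⟩
  let B' : DescModel θ := ⟨0, α ^ 4, 0, s₃, 0, s₅, 0, 0⟩
  let Z' : DescModel θ := ⟨0, 0, 0, 0, 0, 0, 0, l⟩
  have hZ : ∀ c : ZMod p, c.val • Z' = ⟨0, 0, 0, 0, 0, 0, 0, l * c⟩ := by
    intro c
    simp [nsmul_def, Z', mul_comm]
  have hr : DescRel θ' A' B' ⁅B', A'⁆ ⁅⁅B', A'⁆, A'⁆ ⁅⁅⁅B', A'⁆, A'⁆, A'⁆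
      ⁅⁅⁅⁅B', A'⁆, A'⁆, A'⁆, A'⁆ ⁅⁅⁅⁅⁅B', A'⁆, A'⁆, A'⁆, A'⁆, A'⁆ Z' := by
    constructor
    case lie_6a =>
      rw [hZ, hf₁]
      simp only [lie_def, A', B', mk.injEq]
      refine ⟨?_, ?_, ?_, ?_, ?_, ?_, ?_, ?_⟩ <;> first | trivial | ring
    case lie_6b =>
      rw [hZ, hf₂]
      simp only [lie_def, A', B', mk.injEq]
      refine ⟨?_, ?_, ?_, ?_, ?_, ?_, ?_, ?_⟩ <;> first | trivial | ring
    case lie_2b =>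
      rw [hZ, hx]
      simp only [lie_def, add_def, A', B', mk.injEq, zcarry_zero_left]
      refine ⟨?_, ?_, ?_, ?_, ?_, ?_, ?_, ?_⟩ <;> first | trivial | ring
    case lie_4b =>
      rw [hZ, hy]
      simp only [lie_def, A', B', mk.injEq]
      refine ⟨?_, ?_, ?_, ?_, ?_, ?_, ?_, ?_⟩ <;> first | trivial | ring
    case nsmul_a =>
      rw [hZ, hu, prime_nsmul]
      simp only [A', mk.injEq, true_and]
      ring
    case nsmul_b =>
      rw [hZ, hv, prime_nsmul]
      simp only [B', mk.injEq, true_and]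
      ring
    all_goals simp [lie_def, prime_nsmul, Z', zero_def]
  obtain ⟨φ, hφ⟩ := hr.exists_hom
  have hinj : Function.Injective φ := by
    refine (injective_iff_map_eq_zero φ).2 fun g hg => ?_
    rw [hφ] at hg
    have zero : (0 : ZMod p).val = 0 := ZMod.val_zero
    obtain ⟨a, b, c₂, c₃, c₄, c₅, c₆, z⟩ := g
    simp only [lie_def, A', B', hZ] at hg
    have ha := congrArg DescModel.a hg
    simp [add_def, nsmul_def, zero_def, hα] at ha
    subst ha
    have hb := congrArg DescModel.b hg
    simp [add_def, nsmul_def, zero_def, hα] at hb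
    subst hb
    have h₂ := congrArg DescModel.c₂ hg
    simp [add_def, nsmul_def, zero_def, hα] at h₂
    subst h₂
    have h₃ := congrArg DescModel.c₃ hg
    simp [add_def, nsmul_def, zero_def, hα] at h₃
    subst h₃
    have h₄ := congrArg DescModel.c₄ hg
    simp [add_def, nsmul_def, zero_def, hα] at h₄
    subst h₄
    have h₅ := congrArg DescModel.c₅ hg
    simp [add_def, nsmul_def, zero_def, hα] at h₅
    subst h₅
    have h₆ := congrArg DescModel.c₆ hg
    simp [add_def, nsmul_def, zero_def, hα] at h₆
    subst h₆
    have hz := congrArg DescModel.z hg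
    simp [add_def, zero_def, hl] at hz
    subst hz
    rfl
  exact isLieIso_of_bijective φ
    (hinj.bijective_of_nat_card_le (by rw [natCard, natCard]))

theorem exists_of_descRel (hθ' : θ'.f₁ ≠ 0 ∨ θ'.f₂ ≠ 0)
    {A' B' C₂ C₃ C₄ C₅ C₆ Z' : DescModel θ} (h : DescRel θ' A' B' C₂ C₃ C₄ C₅ C₆ Z')
    (hZ : Z' ≠ 0) :
    ∃ α β s₂ s₃ s₄ s₅ l : ZMod p, α ≠ 0 ∧ l ≠ 0 ∧
      l * θ'.f₁ = α ^ 9 * (α * θ.f₁ + β * θ.f₂) ∧ l * θ'.f₂ = α ^ 13 * θ.f₂ ∧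
      l * θ'.x = α ^ 9 * θ.x + (2 * α ^ 5 * s₃ - α * s₂ ^ 2) * θ.y
        + θ.f₂ * (2 * α ^ 5 * s₅ - 2 * α * s₂ * s₄ + α * s₃ ^ 2) ∧
      l * θ'.y = α ^ 11 * θ.y + (2 * α ^ 7 * s₃ - α ^ 3 * s₂ ^ 2) * θ.f₂ ∧
      l * θ'.u = α * θ.u + β * θ.v ∧ l * θ'.v = α ^ 4 * θ.v := by
  obtain ⟨l, rfl⟩ : ∃ l, Z' = ⟨0, 0, 0, 0, 0, 0, 0, l⟩ := by
    have key : ∀ f : ZMod p, f ≠ 0 →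
        f.val • Z' ∈ LieModule.lowerCentralSeries ℤ (DescModel θ) (DescModel θ) 6 →
        ∃ l, Z' = ⟨0, 0, 0, 0, 0, 0, 0, l⟩ := by
      intro f hf hfZ
      obtain ⟨h1, h2, h3, h4, h5, h6, -⟩ := inFiltration_of_mem_lowerCentralSeries hfZ
      refine ⟨Z'.z, ?_⟩
      simp [nsmul_def, hf] at h1 h2 h3 h4 h5 h6
      ext <;> simp [h1, h2, h3, h4, h5, h6]
    rcases hθ' with hf | hf
    · exact key _ hf (h.lie_6a ▸ lie_mem_lcs_succ h.mem_lcs A')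
    · exact key _ hf (h.lie_6b ▸ lie_mem_lcs_succ h.mem_lcs B')
  have hl : l ≠ 0 := by
    rintro rfl
    exact hZ rfl
  have hZ' : ∀ c : ZMod p, c.val • (⟨0, 0, 0, 0, 0, 0, 0, l⟩ : DescModel θ)
      = ⟨0, 0, 0, 0, 0, 0, 0, l * c⟩ := by
    intro c
    simp [nsmul_def, mul_comm]
  obtain ⟨rfl, rfl, rfl, rfl, rfl, h6a, h6b, h2b, h4b, -, -, ha, hb, -⟩ := h
  obtain ⟨α, β, r₂, r₃, r₄, r₅, r₆, r⟩ := A'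
  obtain ⟨γ, δ, s₂, s₃, s₄, s₅, s₆, s⟩ := B'
  simp only [hZ', lie_def, prime_nsmul, add_def, mk.injEq] at h6a h6b h2b h4b ha hb
  obtain ⟨-, -, -, -, -, -, -, h6a⟩ := h6a
  obtain ⟨-, -, -, -, -, -, -, h6b⟩ := h6b
  obtain ⟨-, -, -, -, -, -, -, h4b⟩ := h4b
  obtain ⟨-, -, -, -, -, -, -, ha⟩ := ha
  obtain ⟨-, -, -, -, -, -, -, hb⟩ := hb
  obtain ⟨-, -, -, e3, -, -, e6, h2b⟩ := h2b
  have hD : δ * α - γ * β ≠ 0 := by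
    intro hD
    have h1 : l * θ'.f₁ = 0 := by
      linear_combination -h6a + (θ.f₁ * α ^ 5 + θ.f₂ * α ^ 4 * β) * hD
    have h2 : l * θ'.f₂ = 0 := by
      linear_combination -h6b + (θ.f₁ * α ^ 4 * γ + θ.f₂ * α ^ 4 * δ) * hD
    simp [hl] at h1 h2
    exact hθ'.elim (· h1) (· h2)
  have hγ : γ = 0 := by
    refine (mul_eq_zero.1 ?_).resolve_left hD
    linear_combination e3
  subst hγ
  have hα : α ≠ 0 := by
    rintro rfl
    simp at hD
  have hδ : δ = α ^ 4 := by
    refine mul_left_cancel₀ hD ?_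
    linear_combination e6
  subst hδ
  refine ⟨α, β, s₂, s₃, s₄, s₅, l, hα, hl, ?_, ?_, ?_, ?_, ?_, ?_⟩
  · linear_combination -h6a
  · linear_combination -h6b
  · simp at h2b
    linear_combination -h2b
  · linear_combination -h4b
  · linear_combination -ha
  · linear_combination -hb

theorem exists_of_isLieIso (hθ' : θ'.f₁ ≠ 0 ∨ θ'.f₂ ≠ 0)
    (h : IsLieIso (DescModel θ') (DescModel θ)) :
    ∃ α β s₂ s₃ s₄ s₅ l : ZMod p, α ≠ 0 ∧ l ≠ 0 ∧
      l * θ'.f₁ = α ^ 9 * (α * θ.f₁ + β * θ.f₂) ∧ l * θ'.f₂ = α ^ 13 * θ.f₂ ∧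
      l * θ'.x = α ^ 9 * θ.x + (2 * α ^ 5 * s₃ - α * s₂ ^ 2) * θ.y
        + θ.f₂ * (2 * α ^ 5 * s₅ - 2 * α * s₂ * s₄ + α * s₃ ^ 2) ∧
      l * θ'.y = α ^ 11 * θ.y + (2 * α ^ 7 * s₃ - α ^ 3 * s₂ ^ 2) * θ.f₂ ∧
      l * θ'.u = α * θ.u + β * θ.v ∧ l * θ'.v = α ^ 4 * θ.v := by
  obtain ⟨e⟩ := h.exists_lieEquiv
  refine exists_of_descRel hθ' ((descRel θ').map e.toLieHom) fun h0 => Z_ne_zero (e.injective ?_)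
  exact h0.trans (map_zero e.toLieHom).symm

end DescModel

/-- Normal forms of the structure constants of descendants, in four families with two parameters,
the coordinates of `pa` and `pb`. -/
def descRep {p : ℕ} (t : Fin 4) (w : ZMod p × ZMod p) : DescParam p :=
  ⟨![0, 1, 1, 1] t, ![1, 0, 0, 0] t, ![0, 0, 1, 0] t, ![0, 1, 0, 0] t, w.1, w.2⟩

/-- The relation between the parameters of isomorphic normal forms in the same family. -/
def RepRel {F : Type*} [Field F] : Fin 4 → F × F → F × F → Prop
  | 0 => fun w' w => ∃ α ≠ 0, α ^ 12 * w'.1 = w.1 ∧ α ^ 9 * w'.2 = w.2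
  | 3 => fun w' w => ∃ α ≠ 0, (∃ β, α ^ 10 * w'.1 = α * w.1 + β * w.2) ∧ α ^ 6 * w'.2 = w.2
  | _ => fun w' w => (∃ β, w'.1 = w.1 + β * w.2) ∧ w'.2 = w.2

namespace DescModel

variable {p : ℕ} [Fact p.Prime]

theorem descRep_ne_zero (t : Fin 4) (w : ZMod p × ZMod p) :
    (descRep t w).f₁ ≠ 0 ∨ (descRep t w).f₂ ≠ 0 := by
  fin_cases t <;> simp [descRep]

theorem exists_isLieIso_descRep (h2 : (2 : ZMod p) ≠ 0) {θ : DescParam p}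
    (hθ : θ.f₁ ≠ 0 ∨ θ.f₂ ≠ 0) :
    ∃ (t : Fin 4) (w : ZMod p × ZMod p), IsLieIso (DescModel (descRep t w)) (DescModel θ) := by
  obtain ⟨f₁, f₂, x, y, u, v⟩ := θ
  by_cases hf₂ : f₂ = 0
  · subst hf₂
    have hf₁ : f₁ ≠ 0 := by simpa using hθ
    by_cases hy : y = 0
    · subst hy
      by_cases hx : x = 0
      · subst hx
        exact ⟨3, (u / f₁, v / f₁), isLieIso_of_param (α := 1) (β := 0) (s₃ := 0) (s₅ := 0)
          one_ne_zero hf₁ (by simp [descRep]) (by simp [descRep]) (by simp [descRep])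
          (by simp [descRep]) (by simp [descRep]; field_simp) (by simp [descRep]; field_simp)⟩
      · refine ⟨2, (x / f₁ * u / ((x / f₁) ^ 10 * f₁), (x / f₁) ^ 4 * v / ((x / f₁) ^ 10 * f₁)),
          isLieIso_of_param (α := x / f₁) (β := 0) (s₃ := 0) (s₅ := 0) (l := (x / f₁) ^ 10 * f₁)
          (by positivity) (by positivity) ?_ ?_ ?_ ?_ ?_ ?_⟩ <;> simp [descRep] <;> field_simp
    · refine ⟨1, (f₁ / y * u / ((f₁ / y) ^ 10 * f₁), (f₁ / y) ^ 4 * v / ((f₁ / y) ^ 10 * f₁)),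
          isLieIso_of_param (α := f₁ / y) (β := 0) (s₃ := -((f₁ / y) ^ 4 * x / (2 * y))) (s₅ := 0)
          (l := (f₁ / y) ^ 10 * f₁)
          (by positivity) (by positivity) ?_ ?_ ?_ ?_ ?_ ?_⟩ <;> simp [descRep] <;> field_simp
      ring
  · refine ⟨0, ((u - f₁ / f₂ * v) / f₂, v / f₂), isLieIso_of_param (α := 1) (β := -(f₁ / f₂))
      (s₃ := -(y / (2 * f₂)))
      (s₅ := -((x + 2 * -(y / (2 * f₂)) * y + f₂ * (y / (2 * f₂)) ^ 2) / (2 * f₂)))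
      (l := f₂) one_ne_zero hf₂ ?_ ?_ ?_ ?_ ?_ ?_⟩ <;> simp [descRep] <;> field_simp <;> ring

theorem isLieIso_descRep_of_repRel {t : Fin 4} {w' w : ZMod p × ZMod p} (h : RepRel t w' w) :
    IsLieIso (DescModel (descRep t w')) (DescModel (descRep t w)) := by
  fin_cases t
  · obtain ⟨α, hα, hu, hv⟩ := h
    refine isLieIso_of_param (α := α) (β := 0) (s₃ := 0) (s₅ := 0) (l := α ^ 13) hα
      (pow_ne_zero _ hα) ?_ ?_ ?_ ?_ ?_ ?_ <;> simp [descRep, ← hu, ← hv] <;> ring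
  · obtain ⟨⟨β, hu⟩, hv⟩ := h
    refine isLieIso_of_param (α := 1) (β := β) (s₃ := 0) (s₅ := 0) (l := 1) one_ne_zero
      one_ne_zero ?_ ?_ ?_ ?_ ?_ ?_ <;> simp [descRep, hu, hv]
  · obtain ⟨⟨β, hu⟩, hv⟩ := h
    refine isLieIso_of_param (α := 1) (β := β) (s₃ := 0) (s₅ := 0) (l := 1) one_ne_zero
      one_ne_zero ?_ ?_ ?_ ?_ ?_ ?_ <;> simp [descRep, hu, hv]
  · obtain ⟨α, hα, ⟨β, hu⟩, hv⟩ := h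
    refine isLieIso_of_param (α := α) (β := β) (s₃ := 0) (s₅ := 0) (l := α ^ 10) hα
      (pow_ne_zero _ hα) ?_ ?_ ?_ ?_ ?_ ?_ <;> simp [descRep, hu, ← hv] <;> ring

theorem repRel_of_isLieIso_descRep {t' t : Fin 4} {w' w : ZMod p × ZMod p}
    (h : IsLieIso (DescModel (descRep t' w')) (DescModel (descRep t w))) :
    t' = t ∧ RepRel t w' w := by
  obtain ⟨α, β, s₂, s₃, s₄, s₅, l, hα, hl, hf₁, hf₂, hx, hy, hu, hv⟩ :=
    exists_of_isLieIso (descRep_ne_zero t' w') h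
  obtain ⟨u', v'⟩ := w'
  obtain ⟨u, v⟩ := w
  have h₀ : ∀ n, (0 : ZMod p) ≠ α ^ n := fun n => (pow_ne_zero n hα).symm
  fin_cases t' <;> fin_cases t <;> simp [descRep, hα, hl, h₀] at hf₁ hf₂ hx hy hu hv ⊢
  · subst hf₁ hf₂
    refine ⟨α, hα, mul_left_cancel₀ hα ?_, mul_left_cancel₀ (pow_ne_zero 4 hα) ?_⟩
    · linear_combination hu
    · linear_combination hv
  · have hα1 : α = 1 := mul_left_cancel₀ (pow_ne_zero 10 hα) (by linear_combination hf₁ - hy)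
    subst hα1
    simp at hf₁ hv hu
    subst hf₁
    exact ⟨⟨β, by linear_combination hu⟩, by linear_combination hv⟩
  · have hα1 : α = 1 := mul_left_cancel₀ (pow_ne_zero 9 hα) (by linear_combination hx - hf₁)
    subst hα1
    simp at hx hv hu
    subst hx
    exact ⟨⟨β, by linear_combination hu⟩, by linear_combination hv⟩
  · subst hf₁
    refine ⟨α, hα, ⟨β, ?_⟩, mul_left_cancel₀ (pow_ne_zero 4 hα) ?_⟩
    · linear_combination hu
    · linear_combination hv

end DescModel

theorem natCard_eq_of_surjective {X Q N : Type*} (G : X → Q) (h : X → N)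
    (hG : Function.Surjective G) (hh : Function.Surjective h)
    (H : ∀ x y, G x = G y ↔ h x = h y) : Nat.card Q = Nat.card N := by
  refine Nat.card_eq_of_bijective (h ∘ Function.surjInv hG) ⟨fun a b hab => ?_, fun n => ?_⟩
  · rw [← Function.surjInv_eq hG a, ← Function.surjInv_eq hG b, H]
    exact hab
  · obtain ⟨x, rfl⟩ := hh n
    exact ⟨G x, (H _ _).1 (Function.surjInv_eq hG (G x))⟩

section Units

variable {F : Type*} [Field F]

theorem exists_pow_mul_eq_iff (n : ℕ) (a b : Fˣ) : (∃ α : F, α ≠ 0 ∧ α ^ n * a = b) ↔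
    (a : Fˣ ⧸ (powMonoidHom n : Fˣ →* Fˣ).range) = b := by
  rw [QuotientGroup.eq]
  constructor
  · rintro ⟨α, hα, h⟩
    refine ⟨Units.mk0 α hα, ?_⟩
    rw [eq_inv_mul_iff_mul_eq, mul_comm]
    exact Units.ext h
  · rintro ⟨α, h⟩
    rw [eq_inv_mul_iff_mul_eq, mul_comm] at h
    exact ⟨α, α.ne_zero, congrArg Units.val h⟩

theorem exists_pow_mul_eq_and_iff (m n : ℕ) (a b : Fˣ × Fˣ) :
    (∃ α : F, α ≠ 0 ∧ α ^ m * a.1 = b.1 ∧ α ^ n * a.2 = b.2) ↔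
    (a : (Fˣ × Fˣ) ⧸ ((powMonoidHom m : Fˣ →* Fˣ).prod (powMonoidHom n)).range) = b := by
  rw [QuotientGroup.eq]
  constructor
  · rintro ⟨α, hα, h, h'⟩
    refine ⟨Units.mk0 α hα, ?_⟩
    rw [eq_inv_mul_iff_mul_eq, mul_comm]
    exact Prod.ext (Units.ext h) (Units.ext h')
  · rintro ⟨α, h⟩
    rw [eq_inv_mul_iff_mul_eq, mul_comm] at h
    exact ⟨α, α.ne_zero, congrArg (fun w => (w.1 : F)) h, congrArg (fun w => (w.2 : F)) h⟩

theorem natCard_units_quotient_pow [Finite F] (n : ℕ) :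
    Nat.card (Fˣ ⧸ (powMonoidHom n : Fˣ →* Fˣ).range) = (Nat.card F - 1).gcd n := by
  rw [← Nat.card_units]
  exact IsCyclic.index_powMonoidHom_range Fˣ n

theorem natCard_units_prod_quotient_pow [Finite F] (m n : ℕ) :
    Nat.card ((Fˣ × Fˣ) ⧸ ((powMonoidHom m : Fˣ →* Fˣ).prod (powMonoidHom n)).range) =
      (Nat.card F - 1) * (Nat.card F - 1).gcd (m.gcd n) := by
  set f := (powMonoidHom m : Fˣ →* Fˣ).prod (powMonoidHom n)
  have hk : f.ker = (powMonoidHom (m.gcd n) : Fˣ →* Fˣ).ker := by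
    ext α
    simp only [f, MonoidHom.mem_ker, MonoidHom.prod_apply, powMonoidHom_apply, Prod.mk_eq_one,
      ← orderOf_dvd_iff_pow_eq_one, Nat.dvd_gcd_iff]
  have h1 := Subgroup.card_eq_card_quotient_mul_card_subgroup f.range
  have h2 := Subgroup.card_eq_card_quotient_mul_card_subgroup f.ker
  have h3 : Nat.card (Fˣ ⧸ f.ker) = Nat.card f.range :=
    Nat.card_congr (QuotientGroup.quotientKerEquivRange f).toEquiv
  have h4 : Nat.card f.ker = (Nat.card Fˣ).gcd (m.gcd n) := by
    rw [hk]
    exact IsCyclic.card_powMonoidHom_ker Fˣ _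
  rw [← Nat.card_units]
  rw [Nat.card_prod] at h1
  rw [h3, h4] at h2
  have h0 : 0 < Nat.card f.range := Nat.card_pos
  refine Nat.eq_of_mul_eq_mul_right h0 (h1.symm.trans ?_)
  rw [mul_right_comm, mul_assoc, ← h2]

end Units

section Count

variable {F : Type*} [Field F]

theorem exists_eq_units (w : F) : w = 0 ∨ ∃ c : Fˣ, w = c := by
  by_cases h : w = 0
  · exact Or.inl h
  · exact Or.inr ⟨Units.mk0 w h, rfl⟩

variable [Finite F]

theorem natCard_quot_repRel_zero (he : Equivalence (RepRel (F := F) 0)) :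
    Nat.card (Quot (RepRel (F := F) 0)) = 1 + ((Nat.card F - 1).gcd 12 + ((Nat.card F - 1).gcd 9
      + (Nat.card F - 1) * (Nat.card F - 1).gcd 3)) := by
  let s : Unit ⊕ Fˣ ⊕ Fˣ ⊕ (Fˣ × Fˣ) → F × F := Sum.elim (fun _ => (0, 0))
    (Sum.elim (fun u => (u, 0)) (Sum.elim (fun v => (0, v)) fun w => (w.1, w.2)))
  let h := Sum.map (id : Unit → Unit) (Sum.map (QuotientGroup.mk' (powMonoidHom 12 : Fˣ →* Fˣ).range)
    (Sum.map (QuotientGroup.mk' (powMonoidHom 9 : Fˣ →* Fˣ).range)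
      (QuotientGroup.mk' ((powMonoidHom 12 : Fˣ →* Fˣ).prod (powMonoidHom 9)).range)))
  rw [natCard_eq_of_surjective (fun x => Quot.mk _ (s x)) h ?_ ?_ ?_]
  · simp only [Nat.card_sum, natCard_units_quotient_pow, natCard_units_prod_quotient_pow]
    simp
  · rintro ⟨u, v⟩
    rcases exists_eq_units u with rfl | ⟨u, rfl⟩ <;> rcases exists_eq_units v with rfl | ⟨v, rfl⟩
    · exact ⟨Sum.inl (), rfl⟩
    · exact ⟨Sum.inr (Sum.inr (Sum.inl v)), rfl⟩
    · exact ⟨Sum.inr (Sum.inl u), rfl⟩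
    · exact ⟨Sum.inr (Sum.inr (Sum.inr (u, v))), rfl⟩
  · exact Sum.map_surjective.2 ⟨Function.surjective_id, Sum.map_surjective.2
      ⟨QuotientGroup.mk'_surjective _, Sum.map_surjective.2
        ⟨QuotientGroup.mk'_surjective _, QuotientGroup.mk'_surjective _⟩⟩⟩
  · intro a b
    rw [he.quot_mk_eq_iff]
    rcases a with a | a | a | a <;> rcases b with b | b | b | b <;>
      simp +contextual [s, h, RepRel, eq_comm (a := (0 : F)), ← exists_pow_mul_eq_iff,
        ← exists_pow_mul_eq_and_iff]
    exact ⟨1, one_ne_zero⟩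

theorem natCard_quot_repRel_one (he : Equivalence (RepRel (F := F) 1)) :
    Nat.card (Quot (RepRel (F := F) 1)) = (Nat.card F - 1) + Nat.card F := by
  let s : Fˣ ⊕ F → F × F := Sum.elim (fun v => (0, v)) (fun u => (u, 0))
  rw [natCard_eq_of_surjective (fun x => Quot.mk _ (s x)) id ?_ Function.surjective_id ?_]
  · rw [Nat.card_sum, Nat.card_units]
  · rintro ⟨u, v⟩
    rcases exists_eq_units v with rfl | ⟨v, rfl⟩
    · exact ⟨Sum.inr u, rfl⟩
    · refine ⟨Sum.inl v, Quot.sound ⟨⟨-u / v, ?_⟩, rfl⟩⟩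
      simp [s]
  · intro a b
    rw [he.quot_mk_eq_iff]
    rcases a with a | a <;> rcases b with b | b <;>
      simp +contextual [s, RepRel, Units.ext_iff, eq_comm (a := (0 : F))]

theorem natCard_quot_repRel_three (he : Equivalence (RepRel (F := F) 3)) :
    Nat.card (Quot (RepRel (F := F) 3)) =
      1 + ((Nat.card F - 1).gcd 9 + (Nat.card F - 1).gcd 6) := by
  let s : Unit ⊕ Fˣ ⊕ Fˣ → F × F := Sum.elim (fun _ => (0, 0))
    (Sum.elim (fun u => (u, 0)) fun v => (0, v))
  let h := Sum.map (id : Unit → Unit) (Sum.map (QuotientGroup.mk' (powMonoidHom 9 : Fˣ →* Fˣ).range)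
    (QuotientGroup.mk' (powMonoidHom 6 : Fˣ →* Fˣ).range))
  rw [natCard_eq_of_surjective (fun x => Quot.mk _ (s x)) h ?_ ?_ ?_]
  · simp only [Nat.card_sum, natCard_units_quotient_pow]
    simp
  · rintro ⟨u, v⟩
    rcases exists_eq_units v with rfl | ⟨v, rfl⟩
    · rcases exists_eq_units u with rfl | ⟨u, rfl⟩
      · exact ⟨Sum.inl (), rfl⟩
      · exact ⟨Sum.inr (Sum.inl u), rfl⟩
    · refine ⟨Sum.inr (Sum.inr v), Quot.sound ⟨1, one_ne_zero, ⟨-u / v, ?_⟩, ?_⟩⟩ <;> simp [s]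
  · exact Sum.map_surjective.2 ⟨Function.surjective_id, Sum.map_surjective.2
      ⟨QuotientGroup.mk'_surjective _, QuotientGroup.mk'_surjective _⟩⟩
  · have h9 : ∀ a b : Fˣ, (∃ α : F, α ≠ 0 ∧ α ^ 10 * a = α * b) ↔
        ∃ α : F, α ≠ 0 ∧ α ^ 9 * a = b := by
      refine fun a b => exists_congr fun α => and_congr_right fun hα => ?_
      rw [pow_succ', mul_assoc, mul_right_inj' hα]
    intro a b
    rw [he.quot_mk_eq_iff]
    rcases a with a | a | a <;> rcases b with b | b | b <;>
      simp +contextual [s, h, RepRel, eq_comm (a := (0 : F)), ← exists_pow_mul_eq_iff, h9]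
    exact ⟨1, one_ne_zero⟩

end Count

section Classification

variable {p : ℕ} [Fact p.Prime]

theorem isLieIso_descRep_iff {t' t : Fin 4} {w' w : ZMod p × ZMod p} :
    IsLieIso (DescModel (descRep t' w')) (DescModel (descRep t w)) ↔ t' = t ∧ RepRel t w' w :=
  ⟨DescModel.repRel_of_isLieIso_descRep, by
    rintro ⟨rfl, h⟩
    exact DescModel.isLieIso_descRep_of_repRel h⟩

theorem repRel_equivalence (t : Fin 4) : Equivalence (RepRel (F := ZMod p) t) where
  refl w := (isLieIso_descRep_iff.1 (IsLieIso.refl (DescModel (descRep t w)))).2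
  symm h := (isLieIso_descRep_iff.1 (DescModel.isLieIso_descRep_of_repRel h).symm).2
  trans h h' := (isLieIso_descRep_iff.1 ((DescModel.isLieIso_descRep_of_repRel h).trans
    (DescModel.isLieIso_descRep_of_repRel h'))).2

theorem two_mul_gcd_three {n : ℕ} (hn : 2 ∣ n) : n.gcd 6 = 2 * n.gcd 3 := by
  rw [show 6 = 2 * 3 by rfl, Nat.Coprime.gcd_mul n (by norm_num : Nat.Coprime 2 3),
    Nat.gcd_eq_right hn]

theorem natCard_sigma_quot_repRel (h5 : 5 ≤ p) :
    Nat.card (Σ t : Fin 4, Quot (RepRel (F := ZMod p) t)) =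
      4 * p + (p + 1) * Nat.gcd (p - 1) 3 + 2 * Nat.gcd (p - 1) 9 + Nat.gcd (p - 1) 12 := by
  have h2 : Nat.card (Quot (RepRel (F := ZMod p) 2)) = (Nat.card (ZMod p) - 1)
      + Nat.card (ZMod p) := natCard_quot_repRel_one (repRel_equivalence 1)
  have hp : Odd p := (Fact.out : p.Prime).odd_of_ne_two (by omega)
  have : 2 ∣ p - 1 := (Nat.Odd.sub_odd hp odd_one).two_dvd
  rw [Nat.card_sigma, Fin.sum_univ_four, natCard_quot_repRel_zero (repRel_equivalence 0),
    natCard_quot_repRel_one (repRel_equivalence 1), h2,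
    natCard_quot_repRel_three (repRel_equivalence 3), Nat.card_zmod, two_mul_gcd_three this]
  obtain ⟨n, rfl⟩ : ∃ n, p = n + 1 := ⟨p - 1, by omega⟩
  simp only [Nat.add_sub_cancel]
  ring

/-- A Lie ring structure on `Fin (p ^ 8)` isomorphic to the model. -/
noncomputable abbrev modelLieRing (θ : DescParam p) : LieRing (Fin (p ^ 8)) :=
  transportLieRing (Finite.equivFinOfCardEq (DescModel.natCard θ)).symm

theorem isLieIso_modelLieRing (θ : DescParam p) :
    @IsLieIso (DescModel θ) (Fin (p ^ 8)) _ (modelLieRing θ) :=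
  isLieIso_transport _

theorem isLieIso_modelLieRing_iff (θ' θ : DescParam p) :
    @IsLieIso _ _ (modelLieRing θ') (modelLieRing θ) ↔ IsLieIso (DescModel θ') (DescModel θ) :=
  ⟨fun h => @IsLieIso.trans _ _ _ _ (modelLieRing θ') _ (isLieIso_modelLieRing θ')
      (@IsLieIso.trans _ _ _ (modelLieRing θ') (modelLieRing θ) _ h
        (@IsLieIso.symm _ _ _ (modelLieRing θ) (isLieIso_modelLieRing θ))),
    fun h => @IsLieIso.trans _ _ _ (modelLieRing θ') _ (modelLieRing θ)
      (@IsLieIso.symm _ _ _ (modelLieRing θ') (isLieIso_modelLieRing θ'))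
      (@IsLieIso.trans _ _ _ _ _ (modelLieRing θ) h (isLieIso_modelLieRing θ))⟩

theorem isMaxClassDescendantOf_modelLieRing {θ : DescParam p} (hθ : θ.f₁ ≠ 0 ∨ θ.f₂ ≠ 0) :
    IsMaxClassDescendantOf p (BaseRing p) (modelLieRing θ) :=
  @IsDescendant.of_isLieIso p _ _ (modelLieRing θ) θ hθ (isLieIso_modelLieRing θ)

theorem IsMaxClassDescendantOf.exists_isLieIso_descRep (h2 : (2 : ZMod p) ≠ 0)
    {s : LieRing (Fin (p ^ 8))} (h : IsMaxClassDescendantOf p (BaseRing p) s) :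
    ∃ (t : Fin 4) (w : ZMod p × ZMod p),
      @IsLieIso _ _ (modelLieRing (descRep t w)) s := by
  have h' : IsDescendant p (Fin (p ^ 8)) := h
  obtain ⟨θ, hθ, hi⟩ := h'.exists_isLieIso_model (Nat.card_fin _)
  obtain ⟨t, w, hw⟩ := DescModel.exists_isLieIso_descRep h2 hθ
  exact ⟨t, w, @IsLieIso.trans _ _ _ (modelLieRing _) _ s
    (@IsLieIso.symm _ _ _ (modelLieRing _) (isLieIso_modelLieRing _)) (hw.trans hi)⟩

end Classification

/-- The Lie ring 7.633 : `⟨a,b | [b,a,b]-[b,a,a,a,a,a], [b,a,a,a,b], pa, pb, class 6⟩`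
has `4p + (p+1)gcd(p-1,3) + 2gcd(p-1,9) + gcd(p-1,12)` descendants of order `p^8`
(of maximal class 7). -/
theorem descendants_of_7_633 (p : ℕ) (hp : p.Prime) (h5 : 5 ≤ p) :
    Nat.card (Quot (fun s t :
        {s : LieRing (Fin (p ^ 8)) //
          IsMaxClassDescendantOf p (presLie p {bab - ba5, ba3b}) s} =>
      @IsLieIso _ _ s.1 t.1)) =
    4 * p + (p + 1) * Nat.gcd (p - 1) 3 + 2 * Nat.gcd (p - 1) 9 + Nat.gcd (p - 1) 12 := by
  have : Fact p.Prime := ⟨hp⟩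
  have h2 : (2 : ZMod p) ≠ 0 := by
    intro h
    have : p ∣ 2 := (ZMod.natCast_eq_zero_iff 2 p).1 (by exact_mod_cast h)
    have := Nat.le_of_dvd two_pos this
    omega
  have he : Equivalence (fun s t :
      {s : LieRing (Fin (p ^ 8)) // IsMaxClassDescendantOf p (presLie p {bab - ba5, ba3b}) s} =>
      @IsLieIso _ _ s.1 t.1) :=
    ⟨fun s => @IsLieIso.refl _ s.1, fun {s t} => @IsLieIso.symm _ _ s.1 t.1,
      fun {s t r} => @IsLieIso.trans _ _ _ s.1 t.1 r.1⟩
  rw [← natCard_sigma_quot_repRel h5]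
  refine natCard_eq_of_surjective
    (X := Σ _ : Fin 4, ZMod p × ZMod p)
    (fun x => Quot.mk _ ⟨modelLieRing (descRep x.1 x.2),
      isMaxClassDescendantOf_modelLieRing (DescModel.descRep_ne_zero x.1 x.2)⟩)
    (fun x => ⟨x.1, Quot.mk _ x.2⟩) ?_ ?_ ?_
  · rintro ⟨s, hs⟩
    obtain ⟨t, w, h⟩ := hs.exists_isLieIso_descRep h2
    exact ⟨⟨t, w⟩, Quot.sound h⟩
  · rintro ⟨t, ⟨w⟩⟩
    exact ⟨⟨t, w⟩, rfl⟩
  · rintro ⟨t', w'⟩ ⟨t, w⟩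
    rw [he.quot_mk_eq_iff, isLieIso_modelLieRing_iff, isLieIso_descRep_iff]
    constructor
    · rintro ⟨rfl, h⟩
      exact congrArg (Sigma.mk t') (Quot.sound h)
    · intro h
      obtain ⟨rfl, h⟩ := Sigma.mk.inj_iff.1 h
      exact ⟨rfl, (repRel_equivalence t').quot_mk_eq_iff _ _ |>.1 (eq_of_heq h)⟩
end
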